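/- Every simple graph G that has no isolated edge and at most one isolated vertex has an irreducible distinguishing edge colouring, i.e., there exist a type C and a distinguishing edge colouring c : E(G) → C such that no nontrivial merge of two colours of c is distinguishing. -/

import Mathlib

universe u w

/-- An edge colouring `c` is distinguishing if the identity is the only
automorphism of `G` preserving `c` (where an automorphism `φ` maps an edge
`{u, v}` to the edge `{φ u, φ v}`). -/
def EdgeDistinguishing {V : Type u} {C : Type w} (G : SimpleGraph V) (c : G.edgeSet → C) : Prop :=
  ∀ φ : G ≃g G, (∀ e : G.edgeSet, c (φ.mapEdgeSet e) = c e) → ∀ x : V, φ x = x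

/-- A vertex is isolated if it has no neighbours. -/
def IsolatedVertex {V : Type u} (G : SimpleGraph V) (v : V) : Prop :=
  ∀ u : V, ¬ G.Adj v u

/-- The pair `u, v` forms an isolated edge: `u` and `v` are adjacent and each of
them has no neighbour other than the other one. -/
def IsolatedEdge {V : Type u} (G : SimpleGraph V) (u v : V) : Prop :=
  G.Adj u v ∧ (∀ w : V, G.Adj u w → w = v) ∧ (∀ w : V, G.Adj v w → w = u)

open Classical in
/-- The map merging colour `b` into colour `a`. -/
noncomputable def mergeMap {C : Type w} (a b : C) : C → C :=
  fun x => if x = b then a else x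

namespace IrrCol

open Classical in
theorem exists_fibre_index {Y : Type u} {Z : Type w} (f : Y → Z) :
    ∃ ι : Y → Ordinal.{u}, (∀ y y', f y = f y' → ι y = ι y' → y = y') ∧
      ∀ y i, i < ι y → ∃ y', f y' = f y ∧ ι y' = i := by
  let J : ∀ z : Z, {y : Y // f y = z} → Ordinal.{u} := fun z y =>
    Ordinal.typein (WellOrderingRel (α := {y : Y // f y = z})) y
  refine ⟨fun y => J (f y) ⟨y, rfl⟩, ?_, ?_⟩
  · have key : ∀ z y y' (h : f y = z) (h' : f y' = z), J z ⟨y, h⟩ = J z ⟨y', h'⟩ → y = y' := by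
      intro z y y' h h' e
      have := Ordinal.typein_inj (WellOrderingRel (α := {y : Y // f y = z})) |>.1 e
      exact congrArg Subtype.val this
    intro y y' h e
    refine key (f y') y y' h rfl ?_
    have aux : ∀ z (h : f y = z), J (f y) ⟨y, rfl⟩ = J z ⟨y, h⟩ := by
      rintro _ rfl; rfl
    rw [← aux _ h]; exact e
  · intro y i hi
    have h2 : i < Ordinal.type (WellOrderingRel (α := {y' : Y // f y' = f y})) :=
      hi.trans (Ordinal.typein_lt_type _ _)
    obtain ⟨⟨y', hy'⟩, e⟩ := Ordinal.typein_surj _ h2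
    refine ⟨y', hy', ?_⟩
    have aux : ∀ z (h : f y' = z), J (f y') ⟨y', rfl⟩ = J z ⟨y', h⟩ := by
      rintro _ rfl; rfl
    change J (f y') ⟨y', rfl⟩ = i
    rw [aux _ hy']; exact e

variable {V : Type u} {G : SimpleGraph V}

/-- A set of vertices is connected if every nonempty relatively closed subset is everything. -/
def Conn (G : SimpleGraph V) (S : Set V) : Prop :=
  ∀ T : Set V, T ⊆ S → T.Nonempty → (∀ a ∈ T, ∀ b ∈ S, G.Adj a b → b ∈ T) → S ⊆ T

theorem Conn.image {S : Set V} (h : Conn G S) (φ : G ≃g G) : Conn G (φ '' S) := by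
  intro T hT hne hcl
  have := h (φ ⁻¹' T) ?_ ?_ ?_
  · rintro _ ⟨s, hs, rfl⟩; exact this hs
  · intro a ha
    obtain ⟨s, hs, e⟩ := hT ha
    rwa [← φ.injective e]
  · obtain ⟨t, ht⟩ := hne
    obtain ⟨s, hs, rfl⟩ := hT ht
    exact ⟨s, ht⟩
  · intro a ha b hb hab
    exact hcl _ ha _ ⟨b, hb, rfl⟩ (φ.map_adj_iff.2 hab)

open Classical in
/-- Interchanging two disjoint pieces along an automorphism fixing their common boundary. -/
theorem exists_swap {N N' A : Set V} (φ : G ≃g G) (hφ : φ '' N = N') (hA : ∀ a ∈ A, φ a = a)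
    (hd : ∀ v ∈ N, v ∉ N') (hAN : ∀ v ∈ A, v ∉ N) (hAN' : ∀ v ∈ A, v ∉ N')
    (hN : ∀ a ∈ N, ∀ b, G.Adj a b → b ∈ N ∨ b ∈ A)
    (hN' : ∀ a ∈ N', ∀ b, G.Adj a b → b ∈ N' ∨ b ∈ A) :
    ∃ s : G ≃g G, (∀ v ∈ N, s v = φ v) ∧ (∀ v ∈ N', s v = φ.symm v) ∧
      ∀ v, v ∉ N → v ∉ N' → s v = v := by
  have h1 : ∀ v ∈ N, φ v ∈ N' := fun v hv => hφ ▸ ⟨v, hv, rfl⟩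
  have h2 : ∀ v ∈ N', φ.symm v ∈ N := by
    intro v hv
    rw [← hφ] at hv
    obtain ⟨n, hn, rfl⟩ := hv
    simpa using hn
  have hA' : ∀ a ∈ A, φ.symm a = a := fun a ha => by
    rw [RelIso.symm_apply_eq]; exact (hA a ha).symm
  let f : V → V := fun v => if v ∈ N then φ v else if v ∈ N' then φ.symm v else v
  have fN : ∀ v ∈ N, f v = φ v := fun v hv => by simp [f, hv]
  have fN' : ∀ v ∈ N', f v = φ.symm v := fun v hv => by
    have : v ∉ N := fun h => hd v h hv
    simp [f, hv, this]
  have fO : ∀ v, v ∉ N → v ∉ N' → f v = v := fun v h h' => by simp [f, h, h']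
  have ff : ∀ v, f (f v) = v := by
    intro v
    by_cases hv : v ∈ N
    · rw [fN v hv, fN' _ (h1 v hv)]; simp
    · by_cases hv' : v ∈ N'
      · rw [fN' v hv', fN _ (h2 v hv')]; simp
      · rw [fO v hv hv', fO v hv hv']
  have fadj : ∀ a b, G.Adj a b → G.Adj (f a) (f b) := by
    have fA : ∀ a ∈ A, f a = a := fun a ha => fO a (hAN a ha) (hAN' a ha)
    have key : ∀ a b, a ∈ N → G.Adj a b → G.Adj (f a) (f b) := by
      intro a b ha hab
      rw [fN a ha]
      rcases hN a ha b hab with hb | hb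
      · rw [fN b hb]; exact φ.map_adj_iff.2 hab
      · rw [fA b hb, ← hA b hb]; exact φ.map_adj_iff.2 hab
    have key' : ∀ a b, a ∈ N' → G.Adj a b → G.Adj (f a) (f b) := by
      intro a b ha hab
      rw [fN' a ha]
      rcases hN' a ha b hab with hb | hb
      · rw [fN' b hb]; exact φ.symm.map_adj_iff.2 hab
      · rw [fA b hb, ← hA' b hb]; exact φ.symm.map_adj_iff.2 hab
    intro a b hab
    by_cases ha : a ∈ N
    · exact key a b ha hab
    by_cases ha' : a ∈ N'
    · exact key' a b ha' hab
    by_cases hb : b ∈ N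
    · exact (key b a hb hab.symm).symm
    by_cases hb' : b ∈ N'
    · exact (key' b a hb' hab.symm).symm
    rw [fO a ha ha', fO b hb hb']; exact hab
  refine ⟨⟨⟨f, f, ff, ff⟩, ?_⟩, fN, fN', fO⟩
  intro a b
  refine ⟨fun h => ?_, fadj a b⟩
  have := fadj _ _ h
  simpa [ff] using this

/-- A partially built block structure on the graph. -/
structure Pre (G : SimpleGraph V) where
  F : Set V
  up : V → Set V
  par : V → V
  h : V → ℕ
  att : V → Set V
  τ : V → ZMod 3
  rk : V → Ordinal.{u}
  idx : V → Ordinal.{u}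
  Ψ : Subgroup (G ≃g G)

/-- Strict ancestor. -/
def Pre.lt (s : Pre G) (a b : V) : Prop := b ∈ s.up a ∧ a ∉ s.up b

/-- Membership in the same block. -/
def Pre.eqv (s : Pre G) (a b : V) : Prop := b ∈ s.up a ∧ a ∈ s.up b

/-- Being on the tree path from an attached vertex of the block to its base. -/
def Pre.Sp (s : Pre G) (v : V) : Prop :=
  ∃ a ∈ s.F, s.eqv a v ∧ (s.att a).Nonempty ∧ ∃ n : ℕ, s.par^[n] a = v

/-- The automorphisms preserving the structure except for the indices. -/
def Pre.equi (s : Pre G) : Subgroup (G ≃g G) where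
  carrier := {g | ∀ v, (g v ∈ s.F ↔ v ∈ s.F) ∧ (v ∈ s.F → (∀ a, g a ∈ s.up (g v) ↔ a ∈ s.up v) ∧
    s.par (g v) = g (s.par v) ∧ s.h (g v) = s.h v ∧ s.τ (g v) = s.τ v ∧
    ∀ a, g a ∈ s.att (g v) ↔ a ∈ s.att v)}
  one_mem' := by intro v; simp
  mul_mem' := by
    intro a b ha hb v
    have h1 := ha (b v)
    have h2 := hb v
    refine ⟨h1.1.trans h2.1, fun hv => ?_⟩
    obtain ⟨p1, p2, p3, p4, p5⟩ := h1.2 (h2.1.2 hv)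
    obtain ⟨q1, q2, q3, q4, q5⟩ := h2.2 hv
    refine ⟨fun x => (p1 _).trans (q1 x), ?_, p3.trans q3, p4.trans q4, fun x => (p5 _).trans (q5 x)⟩
    simp only [RelIso.mul_apply]; rw [p2, q2]
  inv_mem' := by
    intro a ha v
    have h1 := ha (a⁻¹ v)
    have e : ∀ x, a (a⁻¹ x) = x := fun x => RelIso.apply_inv_self a x
    rw [e] at h1
    refine ⟨h1.1.symm, fun hv => ?_⟩
    obtain ⟨p1, p2, p3, p4, p5⟩ := h1.2 (h1.1.1 hv)
    refine ⟨fun x => ?_, ?_, p3.symm, p4.symm, fun x => ?_⟩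
    · rw [← p1, e]
    · rw [p2]; simp
    · rw [← p5, e]

/-- The invariants of the construction. -/
structure Good (x y z : V) (s : Pre G) : Prop where
  self : ∀ v ∈ s.F, v ∈ s.up v
  trans : ∀ a ∈ s.F, ∀ b ∈ s.F, b ∈ s.up a → s.up b ⊆ s.up a
  comp : ∀ a ∈ s.F, ∀ b ∈ s.F, ∀ c, c ∈ s.up a → c ∈ s.up b → b ∈ s.up a ∨ a ∈ s.up b
  rk : ∀ a ∈ s.F, ∀ b ∈ s.F, s.lt a b → s.rk a < s.rk b
  nbr : ∀ a ∈ s.F, ∀ b ∈ s.up a, ∀ c, G.Adj b c → c ∈ s.up a ∨ (c ∈ s.F ∧ a ∈ s.up c)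
  conn : ∀ a ∈ s.F, Conn G (s.up a)
  par_F : ∀ v ∈ s.F, s.par v ∈ s.F
  par_eqv : ∀ v ∈ s.F, s.eqv v (s.par v)
  par_zero : ∀ v ∈ s.F, s.h v = 0 → s.par v = v
  par_adj : ∀ v ∈ s.F, s.h v ≠ 0 → G.Adj v (s.par v)
  h_par : ∀ v ∈ s.F, s.h v ≠ 0 → s.h v = s.h (s.par v) + 1
  base : ∀ a ∈ s.F, ∀ b ∈ s.F, s.eqv a b → s.h a = 0 → s.h b = 0 → a = b
  att_F : ∀ v ∈ s.F, ∀ a ∈ s.att v, a ∈ s.F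
  att_lt : ∀ v ∈ s.F, ∀ a ∈ s.att v, s.lt a v
  att_adj : ∀ v ∈ s.F, ∀ a ∈ s.att v, G.Adj a v
  att_τ : ∀ v ∈ s.F, ∀ a ∈ s.att v, s.τ v = s.τ a + 1
  att_uniq : ∀ a ∈ s.F, ∀ b ∈ s.F, s.eqv a b → ∀ c, c ∈ s.att a → c ∈ s.att b → a = b
  cofinal : ∀ a ∈ s.F, ∀ b ∈ s.F, s.lt a b →
    ∃ a' ∈ s.F, a' ∈ s.up a ∧ ∃ b' ∈ s.F, s.eqv b b' ∧ a' ∈ s.att b'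
  sp : ∀ a ∈ s.F, ∀ b ∈ s.F, s.eqv a b → s.lt y a → ¬ s.Sp a → ¬ s.Sp b → a = b
  τ_eqv : ∀ a ∈ s.F, ∀ b ∈ s.F, s.eqv a b → s.τ a = s.τ b
  idx_eqv : ∀ a ∈ s.F, ∀ b ∈ s.F, s.eqv a b → s.idx a = s.idx b
  vis : ∀ a ∈ s.F, ∀ b ∈ s.up a, b ≠ a → s.h a ≠ 0 ∨ ∃ c ∈ s.F, s.h c ≠ 0 ∧ s.par c = a
  semi : ∀ ψ ∈ s.Ψ, ∀ v, v ∉ s.F → (∀ a ∈ s.F, ψ v ∈ s.up a ↔ v ∈ s.up a) →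
    ψ v = v ∧ ∀ a ∈ s.F, v ∈ s.up a → ψ a = a
  equi : s.Ψ ≤ s.equi
  cert : ∀ v ∈ s.F, ∀ i < s.idx v, ∃ ψ ∈ s.Ψ, (∃ a, ψ a ≠ a) ∧ ∀ a ∈ s.F,
    s.idx (ψ a) = s.idx a ∨ (s.idx a = i ∧ s.idx (ψ a) = s.idx v) ∨
      (s.idx a = s.idx v ∧ s.idx (ψ a) = i)
  twin : ∀ a ∈ s.F, ∀ b ∈ s.F, (∀ c ∈ s.F, s.lt c a ↔ s.lt c b) → ∀ φ : G ≃g G,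
    (∀ c ∈ s.F, s.lt c a → φ c = c) → φ '' s.up a = s.up b → s.idx a = s.idx b → s.eqv a b
  lim : ∀ a ∈ s.F, ∀ b, b ∉ s.F → (∀ c ∈ s.F, s.lt c a → b ∈ s.up c) →
    ∃ c ∈ s.F, b ∈ s.up c ∧ ¬ s.lt c a
  xF : x ∈ s.F
  yF : y ∈ s.F
  zF : z ∈ s.F
  up_y : s.up y = Set.univ
  nonroot : ∀ v ∈ s.F, v = x ∨ v = y ∨ v = z ∨ s.lt y v
  h_y : s.h y = 0
  h_x : s.h x = 1
  h_z : s.h z = 1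
  par_x : s.par x = y
  par_z : s.par z = y
  fix : ∀ ψ ∈ s.Ψ, ψ x = x ∧ ψ y = y ∧ ψ z = z

/-- Extension of structures. -/
def Ext (s t : Pre G) : Prop :=
  s.F ⊆ t.F ∧ s.Ψ ≤ t.Ψ ∧ (∀ v ∈ s.F, t.up v = s.up v ∧ t.par v = s.par v ∧ t.h v = s.h v ∧
    t.att v = s.att v ∧ t.τ v = s.τ v ∧ t.rk v = s.rk v ∧ t.idx v = s.idx v) ∧
  ∀ ψ ∈ s.Ψ, ∀ v ∈ t.F, v ∉ s.F → t.idx (ψ v) = t.idx v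

end IrrCol

namespace IrrCol
variable {V : Type u} {G : SimpleGraph V}

theorem Good.eqv_trans {x y z : V} {s : Pre G} (hs : Good x y z s) {a b c : V}
    (ha : a ∈ s.F) (hb : b ∈ s.F) (hc : c ∈ s.F)
    (h : s.eqv a b) (h' : s.eqv b c) : s.eqv a c :=
  ⟨hs.trans a ha b hb h.1 h'.1, hs.trans c hc b hb h'.2 h.2⟩

theorem Pre.eqv.symm {s : Pre G} {a b : V} (h : s.eqv a b) : s.eqv b a := ⟨h.2, h.1⟩

/-- `a` is the child of `b` in the spanning tree of a block. -/
def Pre.Tree (s : Pre G) (a b : V) : Prop := s.h a ≠ 0 ∧ s.par a = b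

/-- The colours used besides the ordinals. -/
abbrev BaseCol : Type := (ZMod 3 × ZMod 3) ⊕ Fin 3

open Classical in
/-- The colour of the tree edge from `a` to its parent. -/
noncomputable def Pre.tc (s : Pre G) (x z a : V) : BaseCol :=
  if a = x then .inr 1 else if a = z then .inr 2 else .inl (s.τ a, (s.h a : ZMod 3))

open Classical in
/-- The colouring read off from a block structure. -/
noncomputable def Pre.col (s : Pre G) (x z a b : V) : BaseCol ⊕ Ordinal.{u} :=
  if s.Tree a b then .inl (s.tc x z a) else if s.Tree b a then .inl (s.tc x z b)
  else if a ∈ s.att b then .inr (s.idx b) else if b ∈ s.att a then .inr (s.idx a)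
  else .inl (.inr 0)

section
variable {x y z : V} {s : Pre G} (hs : Good x y z s) (hF : ∀ v, v ∈ s.F)
include hs hF

theorem Tree.eqv {a b : V} (h : s.Tree a b) : s.eqv a b := h.2 ▸ hs.par_eqv a (hF a)

theorem Tree.adj {a b : V} (h : s.Tree a b) : G.Adj a b := h.2 ▸ hs.par_adj a (hF a) h.1

theorem Tree.h_eq {a b : V} (h : s.Tree a b) : s.h a = s.h b + 1 := h.2 ▸ hs.h_par a (hF a) h.1

theorem Tree.asymm {a b : V} (h : s.Tree a b) : ¬ s.Tree b a := fun h' => by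
  have h1 := Tree.h_eq hs hF h
  have h2 := Tree.h_eq hs hF h'
  omega

theorem att_not_eqv {a b : V} (h : a ∈ s.att b) : ¬ s.eqv a b :=
  fun e => (hs.att_lt b (hF b) a h).2 e.2

theorem att_asymm {a b : V} (h : a ∈ s.att b) : b ∉ s.att a := fun h' =>
  (hs.att_lt b (hF b) a h).2 (hs.att_lt a (hF a) b h').1

omit hs hF in
theorem col_tree {a b : V} (h : s.Tree a b) : s.col x z a b = .inl (s.tc x z a) := by
  simp [Pre.col, h]

theorem col_tree' {a b : V} (h : s.Tree b a) : s.col x z a b = .inl (s.tc x z b) := by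
  simp [Pre.col, h, Tree.asymm hs hF h]

theorem col_att {a b : V} (h : a ∈ s.att b) : s.col x z a b = .inr (s.idx b) := by
  have h1 : ¬ s.Tree a b := fun t => att_not_eqv hs hF h (Tree.eqv hs hF t)
  have h2 : ¬ s.Tree b a := fun t => att_not_eqv hs hF h (Tree.eqv hs hF t).symm
  simp [Pre.col, h1, h2, h]

theorem col_symm (a b : V) : s.col x z a b = s.col x z b a := by
  by_cases h1 : s.Tree a b
  · rw [col_tree h1, col_tree' hs hF h1]
  by_cases h2 : s.Tree b a
  · rw [col_tree h2, col_tree' hs hF h2]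
  by_cases h3 : a ∈ s.att b
  · have := att_asymm hs hF h3
    simp [Pre.col, h1, h2, h3, this]
  · simp [Pre.col, h1, h2, h3]

omit hs hF in
theorem col_inl {a b : V} {p} (h : s.col x z a b = .inl (.inl p)) :
    (s.Tree a b ∨ s.Tree b a) := by
  unfold Pre.col at h; split_ifs at h <;> simp_all

omit hs hF in
theorem col_inr {a b : V} {i} (h : s.col x z a b = .inr i) :
    (a ∈ s.att b ∧ s.idx b = i) ∨ (b ∈ s.att a ∧ s.idx a = i) := by
  unfold Pre.col at h; split_ifs at h <;> simp_all

omit hF hs in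
theorem tc_one {a : V} : s.tc x z a = .inr 1 ↔ a = x := by
  unfold Pre.tc; split_ifs <;> simp_all

omit hF hs in
theorem tc_two (hxz : x ≠ z) {a : V} : s.tc x z a = .inr 2 ↔ a = z := by
  unfold Pre.tc; split_ifs <;> simp_all

omit hF hs in
theorem tc_inl {a : V} (h : a ≠ x) (h' : a ≠ z) :
    s.tc x z a = .inl (s.τ a, (s.h a : ZMod 3)) := by
  simp [Pre.tc, h, h']

omit hF hs in
theorem col_special {a b c : V} (i : Fin 3) (h0 : i ≠ 0)
    (hi : ∀ a, s.tc x z a = .inr i ↔ a = c) (hc : s.par c = y)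
    (h : s.col x z a b = .inl (.inr i)) :
    (a = c ∧ b = y) ∨ (a = y ∧ b = c) := by
  unfold Pre.col at h
  split_ifs at h with h1 h2 <;> simp [hi] at h
  · subst h; exact Or.inl ⟨rfl, by rw [← h1.2, hc]⟩
  · subst h; exact Or.inr ⟨by rw [← h2.2, hc], rfl⟩
  · exact absurd h.symm h0

/-- Preservation of the colouring by an automorphism. -/
def Pres (s : Pre G) (x z : V) (φ : G ≃g G) : Prop :=
  ∀ a b, G.Adj a b → s.col x z (φ a) (φ b) = s.col x z a b

omit hs hF in
theorem Pres.symm {φ : G ≃g G} (h : Pres s x z φ) : Pres s x z φ.symm := by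
  intro a b hab
  have := h (φ.symm a) (φ.symm b) (φ.symm.map_adj_iff.2 hab)
  simpa using this.symm

variable (hxz : x ≠ z)
include hxz

theorem fix_root {φ : G ≃g G} (hφ : Pres s x z φ) : φ x = x ∧ φ y = y ∧ φ z = z := by
  have tx : s.Tree x y := ⟨by simp [hs.h_x], hs.par_x⟩
  have tz : s.Tree z y := ⟨by simp [hs.h_z], hs.par_z⟩
  have ex := hφ x y (Tree.adj hs hF tx)
  have ez := hφ z y (Tree.adj hs hF tz)
  rw [col_tree tx, tc_one.2 rfl] at ex
  rw [col_tree tz, (tc_two hxz).2 rfl] at ez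
  have hx := col_special 1 (by decide) (fun a => tc_one) hs.par_x ex
  have hz := col_special 2 (by decide) (fun a => tc_two hxz) hs.par_z ez
  have hxy := (Tree.adj hs hF tx).ne
  have hzy := (Tree.adj hs hF tz).ne
  rcases hx with ⟨h1, h2⟩ | ⟨h1, h2⟩ <;> rcases hz with ⟨h3, h4⟩ | ⟨h3, h4⟩
  · exact ⟨h1, h2, h3⟩
  · exact absurd (h2.symm.trans h4) hzy.symm
  · exact absurd (h2.symm.trans h4) hxy
  · exact absurd (h2.symm.trans h4) hxz

theorem tree_map {φ : G ≃g G} (hφ : Pres s x z φ) {a b : V} (t : s.Tree a b) :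
    (s.Tree (φ a) (φ b) ∨ s.Tree (φ b) (φ a)) ∧ s.τ (φ a) = s.τ a := by
  obtain ⟨hx, hy, hz⟩ := fix_root hs hF hxz hφ
  by_cases hax : a = x
  · subst hax
    have : b = y := by rw [← t.2, hs.par_x]
    subst this
    rw [hx, hy]; exact ⟨.inl t, rfl⟩
  by_cases haz : a = z
  · subst haz
    have : b = y := by rw [← t.2, hs.par_z]
    subst this
    rw [hz, hy]; exact ⟨.inl t, rfl⟩
  have e := hφ a b (Tree.adj hs hF t)
  rw [col_tree t, tc_inl hax haz] at e
  have h1 := col_inl e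
  refine ⟨h1, ?_⟩
  have key : ∀ c, s.tc x z c = .inl (s.τ a, (s.h a : ZMod 3)) → s.τ c = s.τ a := by
    intro c hc
    unfold Pre.tc at hc; split_ifs at hc; simp at hc; exact hc.1
  rcases h1 with h1 | h1
  · rw [col_tree h1] at e
    exact key _ (by simpa using e)
  · rw [col_tree' hs hF h1] at e
    rw [hs.τ_eqv _ (hF _) _ (hF _) (Tree.eqv hs hF h1).symm]
    exact key _ (by simpa using e)

theorem eqv_map {φ : G ≃g G} (hφ : Pres s x z φ) {a b : V} (e : s.eqv a b) :
    s.eqv (φ a) (φ b) := by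
  have key : ∀ n a, s.h a = n → ∃ c, s.eqv a c ∧ s.h c = 0 ∧ s.eqv (φ a) (φ c) := by
    intro n
    induction n with
    | zero => intro a ha; exact ⟨a, ⟨hs.self a (hF a), hs.self a (hF a)⟩, ha,
        ⟨hs.self _ (hF _), hs.self _ (hF _)⟩⟩
    | succ n ih =>
      intro a ha
      have t : s.Tree a (s.par a) := ⟨by omega, rfl⟩
      have := Tree.h_eq hs hF t
      obtain ⟨c, h1, h2, h3⟩ := ih (s.par a) (by omega)
      refine ⟨c, hs.eqv_trans (hF _) (hF _) (hF _) (Tree.eqv hs hF t) h1, h2,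
        hs.eqv_trans (hF _) (hF _) (hF _) ?_ h3⟩
      rcases (tree_map hs hF hxz hφ t).1 with h | h
      · exact Tree.eqv hs hF h
      · exact (Tree.eqv hs hF h).symm
  obtain ⟨c, h1, h2, h3⟩ := key _ a rfl
  obtain ⟨d, h4, h5, h6⟩ := key _ b rfl
  have : c = d := hs.base c (hF _) d (hF _) (hs.eqv_trans (hF _) (hF _) (hF _) h1.symm
    (hs.eqv_trans (hF _) (hF _) (hF _) e h4)) h2 h5
  subst this
  exact hs.eqv_trans (hF _) (hF _) (hF _) h3 h6.symm

theorem vis_τ {φ : G ≃g G} (hφ : Pres s x z φ) {a b : V} (hb : b ∈ s.up a) (hne : b ≠ a) :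
    s.τ (φ a) = s.τ a := by
  rcases hs.vis a (hF a) b hb hne with h | ⟨c, -, h1, h2⟩
  · exact (tree_map hs hF hxz hφ ⟨h, rfl⟩).2
  · have t : s.Tree c a := ⟨h1, h2⟩
    rw [hs.τ_eqv _ (hF _) _ (hF _) (eqv_map hs hF hxz hφ (Tree.eqv hs hF t).symm),
      (tree_map hs hF hxz hφ t).2, hs.τ_eqv _ (hF _) _ (hF _) (Tree.eqv hs hF t)]

theorem att_map {φ : G ≃g G} (hφ : Pres s x z φ) {a b : V} (h : a ∈ s.att b) :
    φ a ∈ s.att (φ b) ∧ s.idx (φ b) = s.idx b := by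
  have e := hφ a b (hs.att_adj b (hF b) a h)
  rw [col_att hs hF h] at e
  rcases col_inr e with h1 | ⟨h1, h2⟩
  · exact h1
  exfalso
  have l1 := hs.att_lt b (hF b) a h
  have l2 := hs.att_lt _ (hF _) _ h1
  have ne1 : b ≠ a := (hs.att_adj b (hF b) a h).ne.symm
  have t1 := hs.att_τ b (hF b) a h
  have t2 := hs.att_τ _ (hF _) _ h1
  have v1 := vis_τ hs hF hxz hφ l1.1 ne1
  have v2 := vis_τ hs hF hxz hφ.symm l2.1 (fun e => ne1 (φ.injective e).symm)
  simp only [RelIso.symm_apply_apply] at v2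
  rw [v1, ← v2] at t2
  have key : ∀ p q : ZMod 3, q = p + 1 → p ≠ q + 1 := by decide
  exact key _ _ t1 t2

theorem par_map {φ : G ≃g G} (hφ : Pres s x z φ) {a : V} (h : φ a = a) :
    φ (s.par a) = s.par a := by
  by_cases h0 : s.h a = 0
  · rw [hs.par_zero a (hF a) h0, h]
  have t : s.Tree a (s.par a) := ⟨h0, rfl⟩
  obtain ⟨hx, hy, hz⟩ := fix_root hs hF hxz hφ
  by_cases hax : a = x
  · rw [hax, hs.par_x, hy]
  by_cases haz : a = z
  · rw [haz, hs.par_z, hy]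
  have e := hφ a _ (Tree.adj hs hF t)
  rw [col_tree t, tc_inl hax haz] at e
  rcases (tree_map hs hF hxz hφ t).1 with h1 | h1
  · rw [← h1.2, h]
  · exfalso
    rw [col_tree' hs hF h1] at e
    have e2 : s.tc x z (φ (s.par a)) = .inl (s.τ a, (s.h a : ZMod 3)) := by simpa using e
    unfold Pre.tc at e2; split_ifs at e2; simp at e2
    have := Tree.h_eq hs hF h1
    rw [h] at this
    rw [this] at e2
    simp at e2

theorem dist_aux {φ : G ≃g G} (hφ : Pres s x z φ) (v : V)
    (ih : ∀ c, s.lt c v → φ c = c) : φ v = v := by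
  have refl : ∀ a, s.eqv a a := fun a => ⟨hs.self a (hF a), hs.self a (hF a)⟩
  have tr : ∀ {a b c}, s.eqv a b → s.eqv b c → s.eqv a c := fun h h' =>
    hs.eqv_trans (hF _) (hF _) (hF _) h h'
  have lt_tr : ∀ {a b c}, b ∈ s.up a → s.lt b c → s.lt a c := fun {a b c} h h' =>
    ⟨hs.trans a (hF a) b (hF b) h h'.1, fun k => h'.2 (hs.trans c (hF c) a (hF a) k h)⟩
  have lt_tr' : ∀ {a b c}, s.lt a b → c ∈ s.up b → s.lt a c := fun {a b c} h h' =>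
    ⟨hs.trans a (hF a) b (hF b) h.1 h', fun k => h.2 (hs.trans b (hF b) c (hF c) h' k)⟩
  have ih' : ∀ c, s.lt c v → φ.symm c = c := fun c hc => by
    rw [RelIso.symm_apply_eq]; exact (ih c hc).symm
  obtain ⟨hx, hy, hz⟩ := fix_root hs hF hxz hφ
  rcases hs.nonroot v (hF v) with h | h | h | hyv
  · rw [h, hx]
  · rw [h, hy]
  · rw [h, hz]
  set N' := φ '' s.up v with hN'
  have memN : ∀ b, b ∈ N' ↔ φ.symm b ∈ s.up v := by
    intro b
    constructor
    · rintro ⟨a, ha, rfl⟩; simpa using ha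
    · intro h; exact ⟨_, h, by simp⟩
  have cN : Conn G N' := (hs.conn v (hF v)).image φ
  have avoid : ∀ c, s.lt c v → c ∉ N' := by
    intro c hc h
    rw [memN, ih' c hc] at h
    exact hc.2 h
  have vN : φ v ∈ N' := ⟨v, hs.self v (hF v), rfl⟩
  have sub_up : ∀ c, s.lt c v → N' ⊆ s.up c := by
    intro c hc
    obtain ⟨c', -, h1, v', -, h2, h3⟩ := hs.cofinal c (hF c) v (hF v) hc
    have l3 := hs.att_lt v' (hF v') c' h3
    have := (att_map hs hF hxz hφ h3).1
    rw [ih c' (lt_tr' l3 h2.2)] at this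
    have l4 := hs.att_lt _ (hF _) c' this
    have hne : (N' ∩ s.up c).Nonempty :=
      ⟨φ v', ⟨v', h2.1, rfl⟩, hs.trans c (hF c) c' (hF c') h1 l4.1⟩
    refine (cN (N' ∩ s.up c) Set.inter_subset_left hne ?_).trans Set.inter_subset_right
    rintro a ⟨ha1, ha2⟩ b hb hab
    refine ⟨hb, ?_⟩
    rcases hs.nbr c (hF c) a ha2 b hab with h | ⟨-, h⟩
    · exact h
    · exact absurd hb (avoid b (lt_tr h hc))
  obtain ⟨w, hwN, hmin⟩ : ∃ w ∈ N', ∀ b ∈ N', ¬ s.rk b < s.rk w := by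
    obtain ⟨o, ⟨w, hw, rfl⟩, ho⟩ := WellFounded.has_min (wellFounded_lt (α := Ordinal.{u}))
      (s.rk '' N') ⟨_, φ v, vN, rfl⟩
    exact ⟨w, hw, fun b hb => ho _ ⟨b, hb, rfl⟩⟩
  have e1 : N' ⊆ s.up w := by
    refine (cN (N' ∩ s.up w) Set.inter_subset_left ⟨w, hwN, hs.self w (hF w)⟩ ?_).trans
      Set.inter_subset_right
    rintro a ⟨ha1, ha2⟩ b hb hab
    refine ⟨hb, ?_⟩
    rcases hs.nbr w (hF w) a ha2 b hab with h | ⟨-, h⟩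
    · exact h
    · by_contra h'
      exact hmin b hb (hs.rk b (hF b) w (hF w) ⟨h, h'⟩)
  have e2 : s.up w ⊆ N' := by
    refine hs.conn w (hF w) N' e1 ⟨w, hwN⟩ ?_
    intro a ha b hb hab
    rw [memN] at ha ⊢
    rcases hs.nbr v (hF v) _ ha _ (φ.symm.map_adj_iff.2 hab) with h | ⟨-, h⟩
    · exact h
    · by_contra h'
      have hlt : s.lt (φ.symm b) v := ⟨h, h'⟩
      have hbe : b = φ.symm b := by simpa using ih _ hlt
      rw [← hbe] at hlt
      exact avoid w (lt_tr hb hlt) hwN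
  have e : N' = s.up w := e1.antisymm e2
  have lt1 : ∀ c, s.lt c v → s.lt c w := fun c hc =>
    ⟨sub_up c hc hwN, fun h => avoid c hc (e2 h)⟩
  have lt2 : ∀ c, s.lt c w → s.lt c v := by
    intro c hc
    obtain ⟨c', -, h1, w', -, h2, h3⟩ := hs.cofinal c (hF c) w (hF w) hc
    have l := hs.att_lt w' (hF w') c' h3
    have l' := hs.att_lt _ (hF _) _ (att_map hs hF hxz hφ.symm h3).1
    have hw'N := e2 h2.1
    rw [memN] at hw'N
    have hc' : φ.symm c' ∉ s.up v := by
      rw [← memN, e]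
      exact fun h => l.2 (hs.trans w' (hF _) w (hF _) h2.2 h)
    have hlt : s.lt (φ.symm c') v := by
      rcases hs.comp _ (hF (φ.symm c')) v (hF v) _ l'.1 hw'N with h | h
      · exact ⟨h, hc'⟩
      · exact absurd h hc'
    have := ih _ hlt
    simp only [RelIso.apply_symm_apply] at this
    rw [← this] at hlt
    exact lt_tr h1 hlt
  have hvw : s.eqv (φ v) w := by
    refine ⟨?_, e1 vN⟩
    by_contra hn
    obtain ⟨c', -, h1, v', -, h2, h3⟩ := hs.cofinal w (hF w) (φ v) (hF _) ⟨e1 vN, hn⟩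
    have q := eqv_map hs hF hxz hφ.symm h2
    simp only [RelIso.symm_apply_apply] at q
    have l' := hs.att_lt _ (hF _) _ (att_map hs hF hxz hφ.symm h3).1
    have hlt := lt_tr' l' q.2
    have := ih _ hlt
    simp only [RelIso.apply_symm_apply] at this
    rw [← this] at hlt
    exact avoid _ hlt (e2 h1)
  have hidx : s.idx v = s.idx w := by
    obtain ⟨c', -, h1, v', -, h2, h3⟩ := hs.cofinal y (hF y) v (hF _) hyv
    rw [hs.idx_eqv _ (hF _) _ (hF _) h2, ← (att_map hs hF hxz hφ h3).2]
    exact hs.idx_eqv _ (hF _) _ (hF _) (tr (eqv_map hs hF hxz hφ h2.symm) hvw)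
  have hvw' : s.eqv v w := hs.twin v (hF v) w (hF w) (fun c _ => ⟨lt1 c, lt2 c⟩) φ
    (fun c _ => ih c) e hidx
  have hvφ : s.eqv v (φ v) := tr hvw' hvw.symm
  have fixSp : ∀ b, s.eqv v b → s.Sp b → φ b = b := by
    rintro b hvb ⟨a, -, hab, ⟨c, hc⟩, n, rfl⟩
    have hva := tr hvb hab.symm
    have hca : φ c = c := ih c (lt_tr' (hs.att_lt a (hF a) c hc) hva.2)
    have h1 := (att_map hs hF hxz hφ hc).1
    rw [hca] at h1
    have ha : φ a = a := hs.att_uniq _ (hF _) _ (hF _)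
      (tr (eqv_map hs hF hxz hφ hva.symm) (tr hvφ.symm hva)) c h1 hc
    have : ∀ n, φ (s.par^[n] a) = s.par^[n] a := by
      intro n
      induction n with
      | zero => exact ha
      | succ n ih => rw [Function.iterate_succ_apply']; exact par_map hs hF hxz hφ ih
    exact this n
  by_cases h1 : s.Sp v
  · exact fixSp v (refl v) h1
  by_cases h2 : s.Sp (φ v)
  · exact φ.injective (fixSp _ hvφ h2)
  exact (hs.sp v (hF v) _ (hF _) hvφ hyv h1 h2).symm

theorem dist {φ : G ≃g G} (hφ : Pres s x z φ) (v : V) : φ v = v := by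
  have : ∀ o v, s.rk v = o → φ v = v := by
    intro o
    induction o using WellFoundedLT.induction with
    | ind o ih =>
      rintro v rfl
      exact dist_aux hs hF hxz hφ v fun c hc =>
        ih _ (hs.rk c (hF c) v (hF v) hc) c rfl
  exact this _ v rfl

omit hxz in
theorem unmerge {i j : Ordinal.{u}} (hij : i < j) {a b : V}
    (hab : s.col x z a b = .inr j) : ∃ ψ : G ≃g G, (∃ v, ψ v ≠ v) ∧ ∀ u v,
      s.col x z (ψ u) (ψ v) = s.col x z u v ∨
      (s.col x z u v = .inr i ∧ s.col x z (ψ u) (ψ v) = .inr j) ∨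
      (s.col x z u v = .inr j ∧ s.col x z (ψ u) (ψ v) = .inr i) := by
  obtain ⟨v, hv⟩ : ∃ v, s.idx v = j := by
    rcases col_inr hab with h | h
    · exact ⟨_, h.2⟩
    · exact ⟨_, h.2⟩
  subst hv
  obtain ⟨ψ, hψ, hne, H⟩ := hs.cert v (hF v) i hij
  refine ⟨ψ, hne, ?_⟩
  have E := fun v => (hs.equi hψ v).2 (hF v)
  obtain ⟨hx, hy, hz⟩ := hs.fix ψ hψ
  have hT : ∀ a b, s.Tree (ψ a) (ψ b) ↔ s.Tree a b := by
    intro a b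
    unfold Pre.Tree
    rw [(E a).2.2.1, (E a).2.1, ψ.injective.eq_iff]
  have htc : ∀ a, s.tc x z (ψ a) = s.tc x z a := by
    intro a
    have h1 : ψ a = x ↔ a = x := by rw [← hx, ψ.injective.eq_iff, hx]
    have h2 : ψ a = z ↔ a = z := by rw [← hz, ψ.injective.eq_iff, hz]
    unfold Pre.tc
    rw [(E a).2.2.1, (E a).2.2.2.1]
    classical exact if_congr h1 rfl (if_congr h2 rfl rfl)
  have hatt : ∀ a b, ψ a ∈ s.att (ψ b) ↔ a ∈ s.att b := fun a b => (E b).2.2.2.2 a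
  intro a b
  by_cases t1 : s.Tree a b
  · left; rw [col_tree ((hT a b).2 t1), col_tree t1, htc]
  by_cases t2 : s.Tree b a
  · left; rw [col_tree' hs hF ((hT b a).2 t2), col_tree' hs hF t2, htc]
  by_cases t3 : a ∈ s.att b
  · rw [col_att hs hF ((hatt a b).2 t3), col_att hs hF t3]
    simpa using H b (hF b)
  by_cases t4 : b ∈ s.att a
  · rw [col_symm hs hF, col_symm hs hF a b, col_att hs hF ((hatt b a).2 t4), col_att hs hF t4]
    simpa using H a (hF a)
  left
  have r1 : ¬ s.Tree (ψ a) (ψ b) := fun h => t1 ((hT a b).1 h)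
  have r2 : ¬ s.Tree (ψ b) (ψ a) := fun h => t2 ((hT b a).1 h)
  have r3 : ψ a ∉ s.att (ψ b) := fun h => t3 ((hatt a b).1 h)
  have r4 : ψ b ∉ s.att (ψ a) := fun h => t4 ((hatt b a).1 h)
  unfold Pre.col
  rw [if_neg t1, if_neg t2, if_neg t3, if_neg t4, if_neg r1, if_neg r2, if_neg r3, if_neg r4]

end
end IrrCol

namespace IrrCol
variable {V : Type u} {G : SimpleGraph V}

/-- The graph induced on the vertices that are not yet treated. -/
def Pre.off (s : Pre G) : SimpleGraph V where
  Adj a b := G.Adj a b ∧ a ∉ s.F ∧ b ∉ s.F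
  symm := ⟨fun _ _ h => ⟨h.1.symm, h.2.2, h.2.1⟩⟩
  loopless := ⟨fun _ h => h.1.ne rfl⟩

/-- The component of `w` among the untreated vertices. -/
def Pre.cp (s : Pre G) (w : V) : Set V := {b | s.off.Reachable w b}

theorem cp_self (s : Pre G) (w : V) : w ∈ s.cp w := SimpleGraph.Reachable.refl w

theorem cp_eq {s : Pre G} {w b : V} (h : b ∈ s.cp w) : s.cp b = s.cp w := by
  ext c
  exact ⟨fun h' => SimpleGraph.Reachable.trans h h', fun h' => (SimpleGraph.Reachable.symm h).trans h'⟩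

theorem reachable_induction {H : SimpleGraph V} {P : V → Prop} {a b : V} (h : H.Reachable a b)
    (ha : P a) (step : ∀ c d, H.Adj c d → P c → P d) : P b := by
  obtain ⟨p⟩ := h
  induction p with
  | nil => exact ha
  | cons h _ ih => exact ih (step _ _ h ha)

theorem cp_off {s : Pre G} {w b : V} (hw : w ∉ s.F) (h : b ∈ s.cp w) : b ∉ s.F :=
  reachable_induction (P := fun b => b ∉ s.F) h hw fun _ _ hcd _ => hcd.2.2

theorem conn_cp (s : Pre G) (w : V) : Conn G (s.cp w) := by
  rintro T hT ⟨t, ht⟩ hcl b hb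
  have hb' : b ∈ s.cp t := by rw [cp_eq (hT ht)]; exact hb
  refine reachable_induction (P := fun b => b ∈ T) hb' ht ?_
  intro c d hcd hc
  exact hcl c hc d (SimpleGraph.Reachable.trans (hT hc) hcd.reachable) hcd.1

theorem equi_F {s : Pre G} {g : G ≃g G} (hg : g ∈ s.equi) (v : V) : g v ∈ s.F ↔ v ∈ s.F :=
  (hg v).1

theorem equi_up {s : Pre G} {g : G ≃g G} (hg : g ∈ s.equi) {u : V} (hu : u ∈ s.F) (v : V) :
    g v ∈ s.up (g u) ↔ v ∈ s.up u := ((hg u).2 hu).1 v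

theorem equi_up' {s : Pre G} {g : G ≃g G} (hg : g ∈ s.equi) {u : V} (hu : u ∈ s.F) (v : V) :
    g v ∈ s.up u ↔ v ∈ s.up (g⁻¹ u) := by
  have := equi_up hg ((equi_F (inv_mem hg) u).2 hu) v
  rwa [RelIso.apply_inv_self] at this

theorem equi_cp {s : Pre G} {g : G ≃g G} (hg : g ∈ s.equi) (w b : V) :
    g b ∈ s.cp (g w) ↔ b ∈ s.cp w := by
  have key : ∀ g ∈ s.equi, ∀ w b, b ∈ s.cp w → g b ∈ s.cp (g w) := by
    intro g hg w b h
    refine reachable_induction (P := fun b => g b ∈ s.cp (g w)) h (cp_self _ _) ?_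
    intro c d hcd hc
    refine SimpleGraph.Reachable.trans hc (SimpleGraph.Adj.reachable ?_)
    exact ⟨g.map_adj_iff.2 hcd.1, fun h => hcd.2.1 ((equi_F hg c).1 h),
      fun h => hcd.2.2 ((equi_F hg d).1 h)⟩
  refine ⟨fun h => ?_, key g hg w b⟩
  have := key _ (inv_mem hg) _ _ h
  simpa using this

theorem image_cp {s : Pre G} {g : G ≃g G} (hg : g ∈ s.equi) (w : V) :
    g '' s.cp w = s.cp (g w) := by
  ext b
  constructor
  · rintro ⟨b, hb, rfl⟩; exact (equi_cp hg w b).2 hb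
  · intro h
    refine ⟨g⁻¹ b, ?_, by simp⟩
    rw [← equi_cp hg]; simpa using h

/-- Two vertices lie below the same treated vertices. -/
def Pre.same (s : Pre G) (a b : V) : Prop := ∀ u ∈ s.F, a ∈ s.up u ↔ b ∈ s.up u

theorem Pre.same.symm {s : Pre G} {a b : V} (h : s.same a b) : s.same b a :=
  fun u hu => (h u hu).symm

theorem Pre.same.trans {s : Pre G} {a b c : V} (h : s.same a b) (h' : s.same b c) : s.same a c :=
  fun u hu => (h u hu).trans (h' u hu)

theorem equi_same {s : Pre G} {g : G ≃g G} (hg : g ∈ s.equi) {a b : V} (h : s.same a b) :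
    s.same (g a) (g b) := by
  intro u hu
  rw [equi_up' hg hu, equi_up' hg hu]
  exact h _ ((equi_F (inv_mem hg) u).2 hu)

section
variable {x y z : V} {s : Pre G} (hs : Good x y z s)
include hs

theorem cp_same {w b : V} (h : b ∈ s.cp w) : s.same b w := by
  refine reachable_induction (P := fun b => s.same b w) h (fun _ _ => Iff.rfl) ?_
  intro c d hcd hc
  refine Pre.same.trans ?_ hc
  intro u hu
  constructor
  · intro h
    rcases hs.nbr u hu d h c hcd.1.symm with h | h
    · exact h
    · exact absurd h.1 hcd.2.1
  · intro h
    rcases hs.nbr u hu c h d hcd.1 with h | h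
    · exact h
    · exact absurd h.1 hcd.2.2

theorem cp_nbr {w b c : V} (hw : w ∉ s.F) (h : b ∈ s.cp w) (hbc : G.Adj b c) :
    c ∈ s.cp w ∨ (c ∈ s.F ∧ w ∈ s.up c) := by
  have hb := cp_off hw h
  by_cases hc : c ∈ s.F
  · right
    refine ⟨hc, ?_⟩
    rw [← cp_same hs h c hc]
    rcases hs.nbr c hc c (hs.self c hc) b hbc.symm with h | h
    · exact h
    · exact absurd h.1 hb
  · left
    exact SimpleGraph.Reachable.trans h (SimpleGraph.Adj.reachable ⟨hbc, hb, hc⟩)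

theorem equi_of_fix {g : G ≃g G} (h1 : ∀ v ∈ s.F, g v = v)
    (h2 : ∀ v, v ∉ s.F → s.same (g v) v) : g ∈ s.equi := by
  have hF : ∀ v, v ∉ s.F → g v ∉ s.F := by
    intro v hv h
    have := g.injective (h1 _ h)
    rw [this] at h; exact hv h
  intro v
  refine ⟨⟨fun h => by_contra fun h' => hF v h' h, fun h => by rw [h1 v h]; exact h⟩, fun hv => ?_⟩
  rw [h1 v hv, h1 _ (hs.par_F v hv)]
  refine ⟨fun a => ?_, rfl, rfl, rfl, fun a => ?_⟩
  · by_cases ha : a ∈ s.F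
    · rw [h1 a ha]
    · exact h2 a ha v hv
  · by_cases ha : a ∈ s.F
    · rw [h1 a ha]
    · exact ⟨fun h => absurd (hs.att_F v hv _ h) (hF a ha), fun h => absurd (hs.att_F v hv _ h) ha⟩

theorem exists_swap_cp {a b : V} (ha : a ∉ s.F) (hb : b ∉ s.F) (hab : s.same a b) (φ : G ≃g G)
    (hφ : ∀ u ∈ s.F, a ∈ s.up u → φ u = u) (him : φ '' s.cp a = s.cp b)
    (hne : s.cp a ≠ s.cp b) :
    ∃ g ∈ s.equi, (∀ v ∈ s.cp a, g v = φ v) ∧ (∀ v ∈ s.cp b, g v = φ.symm v) ∧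
      (∀ v, v ∉ s.cp a → v ∉ s.cp b → g v = v) ∧ ∀ v, v ∉ s.F → s.same (g v) v := by
  obtain ⟨g, h1, h2, h3⟩ := exists_swap (A := {u | u ∈ s.F ∧ a ∈ s.up u}) φ him
    (fun u hu => hφ u hu.1 hu.2)
    (fun v hv hv' => hne ((cp_eq hv).symm.trans (cp_eq hv')))
    (fun v hv h => cp_off ha h hv.1) (fun v hv h => cp_off hb h hv.1)
    (fun v hv c hc => cp_nbr hs ha hv hc)
    (fun v hv c hc => by
      rcases cp_nbr hs hb hv hc with h | h
      · exact .inl h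
      · exact .inr ⟨h.1, (hab c h.1).2 h.2⟩)
  have hsame : ∀ v, v ∉ s.F → s.same (g v) v := by
    intro v hv
    by_cases hva : v ∈ s.cp a
    · have : g v ∈ s.cp b := by rw [h1 v hva, ← him]; exact ⟨v, hva, rfl⟩
      exact (cp_same hs this).trans (hab.symm.trans (cp_same hs hva).symm)
    by_cases hvb : v ∈ s.cp b
    · have : g v ∈ s.cp a := by
        rw [h2 v hvb]
        rw [← him] at hvb
        obtain ⟨c, hc, rfl⟩ := hvb
        simpa using hc
      exact (cp_same hs this).trans (hab.trans (cp_same hs hvb).symm)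
    · rw [h3 v hva hvb]; exact fun _ _ => Iff.rfl
  exact ⟨g, equi_of_fix hs (fun v hv => h3 v (fun h => cp_off ha h hv) (fun h => cp_off hb h hv))
    hsame, h1, h2, h3, hsame⟩

end

/-- Coherent charts on an orbit of untreated vertices. -/
structure IsChart (s : Pre G) (O : Set V) (r : V → V) (κ : V → G ≃g G) (ι : V → Ordinal.{u})
    (Ψ' : Subgroup (G ≃g G)) : Prop where
  O_F : ∀ w ∈ O, w ∉ s.F
  O_cl : ∀ w ∈ O, ∀ w', w' ∉ s.F → s.same w' w → w' ∈ O
  r_O : ∀ w ∈ O, r w ∈ O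
  r_inj : ∀ w ∈ O, ∀ w' ∈ s.cp w, r w' = r w → w' = w
  κ_equi : ∀ w ∈ O, κ w ∈ s.equi
  κ_r : ∀ w ∈ O, κ w (r w) = w
  r_κ : ∀ w ∈ O, ∀ n ∈ s.cp (r w), r (κ w n) = n
  κ_F : ∀ w ∈ O, ∀ g ∈ Ψ', ∀ a ∈ s.F, r w ∈ s.up a → κ (g w) a = g (κ w a)
  κ_cp : ∀ w ∈ O, ∀ w' ∈ s.cp w, ∀ a ∈ s.F, r w ∈ s.up a → κ w' a = κ w a
  le : s.Ψ ≤ Ψ'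
  equi : Ψ' ≤ s.equi
  map_O : ∀ g ∈ Ψ', ∀ w ∈ O, g w ∈ O
  r_map : ∀ g ∈ Ψ', ∀ w ∈ O, r (g w) = r w
  proj : ∀ g ∈ Ψ', ∃ ψ ∈ s.Ψ, (∀ v, v ∉ O → g v = ψ v) ∧ ∀ w ∈ O, s.same (g w) (ψ w)
  ι_cp : ∀ w ∈ O, ∀ w' ∈ s.cp w, ι w' = ι w
  ι_Ψ : ∀ ψ ∈ s.Ψ, ∀ w ∈ O, ι (ψ w) = ι w
  cert : ∀ w ∈ O, ∀ i < ι w, ∃ g ∈ Ψ', (∃ a, g a ≠ a) ∧ (∀ v, v ∉ O → g v = v) ∧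
    ∀ a ∈ O, ι (g a) = ι a ∨ (ι a = i ∧ ι (g a) = ι w) ∨ (ι a = ι w ∧ ι (g a) = i)
  twin : ∀ v ∈ O, ∀ w ∈ O, s.same v w → ∀ φ : G ≃g G, (∀ c ∈ s.F, v ∈ s.up c → φ c = c) →
    φ '' s.cp v = s.cp w → ι v = ι w → s.cp v = s.cp w

end IrrCol

namespace IrrCol
variable {V : Type u} {G : SimpleGraph V}

section
variable {x y z : V} {s : Pre G} (hs : Good x y z s)
include hs

theorem Ψ_orbit {ψ₁ ψ₂ : G ≃g G} (h1 : ψ₁ ∈ s.Ψ) (h2 : ψ₂ ∈ s.Ψ) {p₁ p₂ : V} (hp : p₁ ∉ s.F)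
    (h : s.same p₁ p₂) (h' : s.same (ψ₁ p₁) (ψ₂ p₂)) :
    ψ₁ p₁ = ψ₂ p₁ ∧ ∀ a ∈ s.F, p₁ ∈ s.up a → ψ₁ a = ψ₂ a := by
  have hm : ψ₂⁻¹ * ψ₁ ∈ s.Ψ := mul_mem (inv_mem h2) h1
  have hsame : s.same ((ψ₂⁻¹ * ψ₁) p₁) p₁ := by
    have := equi_same (inv_mem (hs.equi h2)) h'
    simp only [RelIso.inv_apply_self] at this
    exact this.trans h.symm
  obtain ⟨e1, e2⟩ := hs.semi _ hm p₁ hp hsame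
  refine ⟨?_, fun a ha hpa => ?_⟩
  · have := congrArg ψ₂ e1
    simpa using this
  · have := congrArg ψ₂ (e2 a ha hpa)
    simpa using this

theorem exists_chart {x₀ : V} (hx₀ : x₀ ∉ s.F) :
    ∃ O r κ ι Ψ', x₀ ∈ O ∧ IsChart s O r κ ι Ψ' := by
  classical
  let P : Set V := {w | w ∉ s.F ∧ s.same w x₀}
  let O : Set V := {w | ∃ ψ ∈ s.Ψ, ∃ p ∈ P, ψ p = w}
  have hx₀P : x₀ ∈ P := ⟨hx₀, fun _ _ => Iff.rfl⟩
  have PO : ∀ p ∈ P, p ∈ O := fun p hp => ⟨1, one_mem _, p, hp, rfl⟩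
  have hO_F : ∀ w ∈ O, w ∉ s.F := by
    rintro w ⟨ψ, hψ, p, hp, rfl⟩
    rw [equi_F (hs.equi hψ)]; exact hp.1
  have hO_Ψ : ∀ ψ ∈ s.Ψ, ∀ w ∈ O, ψ w ∈ O := by
    rintro ψ hψ w ⟨ψ', hψ', p, hp, rfl⟩
    exact ⟨ψ * ψ', mul_mem hψ hψ', p, hp, rfl⟩
  have hO_Ψ' : ∀ ψ ∈ s.Ψ, ∀ w, w ∉ O → ψ w ∉ O := by
    intro ψ hψ w hw h
    have := hO_Ψ _ (inv_mem hψ) _ h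
    simp at this
    exact hw this
  have P_same : ∀ p ∈ P, ∀ q, q ∉ s.F → s.same q p → q ∈ P := fun p hp q hq h =>
    ⟨hq, h.trans hp.2⟩
  have PP : ∀ p ∈ P, ∀ q ∈ P, s.same p q := fun p hp q hq => hp.2.trans hq.2.symm
  have P_cp : ∀ p ∈ P, ∀ q ∈ s.cp p, q ∈ P := fun p hp q hq =>
    P_same p hp q (cp_off hp.1 hq) (cp_same hs hq)
  have h0 : ∀ w, ∃ ψ : G ≃g G, ∃ p, ψ ∈ s.Ψ ∧ p ∈ P ∧ (w ∈ O → ψ p = w) := by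
    intro w
    by_cases hw : w ∈ O
    · obtain ⟨ψ, hψ, p, hp, e⟩ := hw
      exact ⟨ψ, p, hψ, hp, fun _ => e⟩
    · exact ⟨1, x₀, one_mem _, hx₀P, fun h => absurd h hw⟩
  choose ψ p hψ hp hψp using h0
  have p_uniq : ∀ ψ' ∈ s.Ψ, ∀ q ∈ P, p (ψ' q) = q := by
    intro ψ' hψ' q hq
    have hO : ψ' q ∈ O := ⟨ψ', hψ', q, hq, rfl⟩
    have e := hψp _ hO
    have := (Ψ_orbit hs hψ' (hψ (ψ' q)) hq.1 (PP q hq _ (hp (ψ' q))) (by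
      rw [e]; exact fun _ _ => Iff.rfl)).1
    apply (ψ (ψ' q)).injective
    rw [e]; exact this
  have p_P : ∀ q ∈ P, p q = q := fun q hq => p_uniq 1 (one_mem _) q hq
  have p_Ψ : ∀ g ∈ s.Ψ, ∀ w ∈ O, p (g w) = p w := by
    intro g hg w hw
    have := p_uniq (g * ψ w) (mul_mem hg (hψ w)) (p w) (hp w)
    rwa [RelIso.mul_apply, hψp w hw] at this
  have ψinv : ∀ w ∈ O, (ψ w)⁻¹ w = p w := by
    intro w hw
    apply (ψ w).injective
    rw [RelIso.apply_inv_self, hψp w hw]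
  have p_same : ∀ w ∈ O, ∀ w', w' ∉ s.F → s.same w' w → (ψ w)⁻¹ w' ∈ P ∧ p w' = (ψ w)⁻¹ w' := by
    intro w hw w' hw' h
    have hin := inv_mem (hs.equi (hψ w))
    have : (ψ w)⁻¹ w' ∈ P := by
      refine P_same (p w) (hp w) _ ?_ ?_
      · rwa [equi_F hin]
      · have := equi_same hin h
        rwa [ψinv w hw] at this
    refine ⟨this, ?_⟩
    have := p_uniq (ψ w) (hψ w) _ this
    rwa [RelIso.apply_inv_self] at this
  let Y := {N : Set V // ∃ a ∈ P, N = s.cp a}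
  let St : Setoid Y :=
    { r := fun N N' => ∃ φ : G ≃g G, (∀ u ∈ s.F, x₀ ∈ s.up u → φ u = u) ∧ φ '' N.1 = N'.1
      iseqv := by
        refine ⟨fun N => ⟨1, fun _ _ _ => rfl, by simp⟩, ?_, ?_⟩
        · rintro N N' ⟨φ, h1, h2⟩
          refine ⟨φ⁻¹, fun u hu hu' => ?_, ?_⟩
          · nth_rw 1 [← h1 u hu hu']; simp
          · rw [← h2, ← Set.image_comp]; simp
        · rintro N N' N'' ⟨φ, h1, h2⟩ ⟨φ', h1', h2'⟩
          refine ⟨φ' * φ, fun u hu hu' => ?_, ?_⟩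
          · rw [RelIso.mul_apply, h1 u hu hu', h1' u hu hu']
          · rw [← h2', ← h2, ← Set.image_comp]; rfl }
  obtain ⟨ιY, ιinj, ιini⟩ := exists_fibre_index (fun N : Y => Quotient.mk St N)
  let rep : Y → Y := fun N => (Quotient.mk St N).out
  have hrep : ∀ N : Y, St.r (rep N) N := fun N => Quotient.exact (Quotient.out_eq _)
  have Y_mem : ∀ N : Y, ∀ n ∈ N.1, n ∈ P ∧ s.cp n = N.1 := by
    rintro ⟨_, a, ha, rfl⟩ n hn
    exact ⟨P_cp a ha n hn, cp_eq hn⟩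
  have Y_ne : ∀ N : Y, ∃ n, n ∈ N.1 := by
    rintro ⟨_, a, ha, rfl⟩; exact ⟨a, cp_self s a⟩
  -- swaps between components
  have swap : ∀ N N' : Y, N.1 ≠ N'.1 → ∀ φ : G ≃g G, (∀ u ∈ s.F, x₀ ∈ s.up u → φ u = u) →
      φ '' N.1 = N'.1 → ∃ g ∈ s.equi, (∀ v ∈ N.1, g v = φ v) ∧ (∀ v ∈ N'.1, g v = φ.symm v) ∧
      (∀ v, v ∉ N.1 → v ∉ N'.1 → g v = v) ∧ ∀ v, v ∉ s.F → s.same (g v) v := by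
    rintro ⟨_, a, ha, rfl⟩ ⟨_, b, hb, rfl⟩ hne φ h1 h2
    exact exists_swap_cp hs ha.1 hb.1 (PP a ha b hb) φ
      (fun u hu hau => h1 u hu ((ha.2 u hu).1 hau)) h2 hne
  have hsw : ∀ N : Y, ∃ g ∈ s.equi, (∀ u ∈ s.F, g u = u) ∧ g '' (rep N).1 = N.1 := by
    intro N
    by_cases hN : (rep N).1 = N.1
    · exact ⟨1, one_mem _, fun _ _ => rfl, by simpa using hN⟩
    obtain ⟨φ, h1, h2⟩ := hrep N
    obtain ⟨g, hg, g1, -, g3, -⟩ := swap _ _ hN φ h1 h2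
    refine ⟨g, hg, fun u hu => g3 u (fun h => (Y_mem _ _ h).1.1 hu)
      (fun h => (Y_mem _ _ h).1.1 hu), ?_⟩
    rw [← h2]
    exact Set.image_congr g1
  choose sw sw_equi sw_F sw_im using hsw
  let c : V → Y := fun w => ⟨s.cp (p w), p w, hp w, rfl⟩
  have mem_c : ∀ w, p w ∈ (c w).1 := fun w => cp_self _ _
  have c_of : ∀ N : Y, ∀ n ∈ N.1, c n = N := by
    intro N n hn
    obtain ⟨h1, h2⟩ := Y_mem N n hn
    apply Subtype.ext
    change s.cp (p n) = N.1
    rw [p_P n h1, h2]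
  let r : V → V := fun w => (sw (c w))⁻¹ (p w)
  let κ : V → G ≃g G := fun w => ψ w * sw (c w)
  have r_rep : ∀ w, r w ∈ (rep (c w)).1 := by
    intro w
    have := mem_c w
    rw [← sw_im] at this
    obtain ⟨n, hn, e⟩ := this
    change (sw (c w))⁻¹ (p w) ∈ _
    rw [← e]; simpa using hn
  have r_Y : ∀ N : Y, ∀ n ∈ N.1, r n = (sw N)⁻¹ n := by
    intro N n hn
    change (sw (c n))⁻¹ (p n) = _
    rw [c_of N n hn, p_P n (Y_mem N n hn).1]
  have c_cp : ∀ w ∈ O, ∀ w' ∈ s.cp w, c w' = c w := by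
    intro w hw w' hw'
    have hwF := hO_F w hw
    apply Subtype.ext
    change s.cp (p w') = s.cp (p w)
    rw [(p_same w hw w' (cp_off hwF hw') (cp_same hs hw')).2]
    apply cp_eq
    rw [← equi_cp (hs.equi (hψ w)), RelIso.apply_inv_self, hψp w hw]
    exact hw'
  have p_eq : ∀ w ∈ O, ∀ w' ∈ O, s.same w' w → p w' = p w → w' = w := by
    intro w hw w' hw' h e
    rw [(p_same w hw w' (hO_F _ hw') h).2] at e
    rw [← hψp w hw, ← e, RelIso.apply_inv_self]
  have hO_cl : ∀ w ∈ O, ∀ w', w' ∉ s.F → s.same w' w → w' ∈ O := by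
    intro w hw w' hw' h
    refine ⟨ψ w, hψ w, _, (p_same w hw w' hw' h).1, by simp⟩
  have c_Ψ : ∀ g ∈ s.Ψ, ∀ w ∈ O, c (g w) = c w := by
    intro g hg w hw
    apply Subtype.ext
    change s.cp (p (g w)) = s.cp (p w)
    rw [p_Ψ g hg w hw]
  let Ψ' : Subgroup (G ≃g G) :=
    { carrier := {g | g ∈ s.equi ∧ (∃ ψ ∈ s.Ψ, (∀ v, v ∉ O → g v = ψ v) ∧
        ∀ w ∈ O, s.same (g w) (ψ w)) ∧ ∀ w ∈ O, g w ∈ O ∧ r (g w) = r w}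
      one_mem' := ⟨one_mem _, ⟨1, one_mem _, fun _ _ => rfl, fun _ _ _ _ => Iff.rfl⟩,
        fun w hw => ⟨hw, rfl⟩⟩
      mul_mem' := by
        rintro g g' ⟨h1, ⟨ψ, hψ, h2, h3⟩, h4⟩ ⟨h1', ⟨ψ', hψ', h2', h3'⟩, h4'⟩
        refine ⟨mul_mem h1 h1', ⟨ψ * ψ', mul_mem hψ hψ', fun v hv => ?_, fun w hw => ?_⟩,
          fun w hw => ?_⟩
        · rw [RelIso.mul_apply, RelIso.mul_apply, h2' v hv, h2 _ (hO_Ψ' _ hψ' _ hv)]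
        · exact (h3 _ (h4' w hw).1).trans (equi_same (hs.equi hψ) (h3' w hw))
        · exact ⟨(h4 _ (h4' w hw).1).1, ((h4 _ (h4' w hw).1).2).trans (h4' w hw).2⟩
      inv_mem' := by
        rintro g ⟨h1, ⟨ψ, hψ, h2, h3⟩, h4⟩
        have hO : ∀ w ∈ O, g⁻¹ w ∈ O := by
          intro w hw
          by_contra h
          have := h2 _ h
          rw [RelIso.apply_inv_self] at this
          exact hO_Ψ' _ hψ _ h (this ▸ hw)
        refine ⟨inv_mem h1, ⟨ψ⁻¹, inv_mem hψ, fun v hv => ?_, fun w hw => ?_⟩, fun w hw => ?_⟩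
        · have := h2 _ (hO_Ψ' _ (inv_mem hψ) v hv)
          rw [RelIso.apply_inv_self] at this
          nth_rw 1 [← this]; simp
        · have := equi_same (hs.equi (inv_mem hψ)) (h3 _ (hO w hw))
          simp only [RelIso.apply_inv_self, RelIso.inv_apply_self] at this
          exact this.symm
        · refine ⟨hO w hw, ?_⟩
          have := (h4 _ (hO w hw)).2
          rw [RelIso.apply_inv_self] at this
          exact this.symm }
  have hle : s.Ψ ≤ Ψ' := by
    intro g hg
    refine ⟨hs.equi hg, ⟨g, hg, fun _ _ => rfl, fun _ _ _ _ => Iff.rfl⟩,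
      fun w hw => ⟨hO_Ψ g hg w hw, ?_⟩⟩
    change (sw (c (g w)))⁻¹ (p (g w)) = (sw (c w))⁻¹ (p w)
    rw [c_Ψ g hg w hw, p_Ψ g hg w hw]
  have anc : ∀ w ∈ O, ∀ a ∈ s.F, r w ∈ s.up a → p w ∈ s.up a := by
    intro w hw a ha h
    exact (PP _ (hp w) _ (Y_mem _ _ (r_rep w)).1 a ha).2 h
  refine ⟨O, r, κ, fun w => ιY (c w), Ψ', PO _ hx₀P, ?_⟩
  refine ⟨hO_F, hO_cl, fun w hw => PO _ (Y_mem _ _ (r_rep w)).1, ?_,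
    fun w hw => mul_mem (hs.equi (hψ w)) (sw_equi _), ?_, ?_, ?_, ?_, hle, fun g hg => hg.1,
    fun g hg w hw => (hg.2.2 w hw).1, fun g hg w hw => (hg.2.2 w hw).2, fun g hg => hg.2.1, ?_, ?_,
    ?_, ?_⟩
  · intro w hw w' hw' e
    have hwF := hO_F w hw
    have hw'O := hO_cl w hw w' (cp_off hwF hw') (cp_same hs hw')
    refine p_eq w hw w' hw'O (cp_same hs hw') ?_
    change (sw (c w'))⁻¹ (p w') = (sw (c w))⁻¹ (p w) at e
    rw [c_cp w hw w' hw'] at e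
    exact (sw (c w))⁻¹.injective e
  · intro w hw
    change ψ w (sw (c w) ((sw (c w))⁻¹ (p w))) = w
    rw [RelIso.apply_inv_self, hψp w hw]
  · intro w hw n hn
    have hn' : n ∈ (rep (c w)).1 := by rwa [(Y_mem _ _ (r_rep w)).2] at hn
    have h1 : sw (c w) n ∈ (c w).1 := by rw [← sw_im]; exact ⟨n, hn', rfl⟩
    change r (ψ w (sw (c w) n)) = n
    rw [((hle (hψ w)).2.2 _ (PO _ (Y_mem _ _ h1).1)).2, r_Y _ _ h1, RelIso.inv_apply_self]
  · intro w hw g hg a ha hra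
    obtain ⟨hge, ⟨χ, hχ, h1, h2⟩, h3⟩ := hg
    change ψ (g w) (sw (c (g w)) a) = g (ψ w (sw (c w) a))
    rw [sw_F _ _ ha, sw_F _ _ ha]
    have h4 : ψ w a ∉ O := fun h => hO_F _ h ((equi_F (hs.equi (hψ w)) a).2 ha)
    rw [h1 _ h4]
    refine ((Ψ_orbit hs (mul_mem hχ (hψ w)) (hψ (g w)) (hp w).1 (PP _ (hp w) _ (hp (g w))) ?_).2 a
      ha (anc w hw a ha hra)).symm
    rw [hψp _ (h3 w hw).1, RelIso.mul_apply, hψp w hw]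
    exact (h2 w hw).symm
  · intro w hw w' hw' a ha hra
    have hwF := hO_F w hw
    have hw'O := hO_cl w hw w' (cp_off hwF hw') (cp_same hs hw')
    change ψ w' (sw (c w') a) = ψ w (sw (c w) a)
    rw [sw_F _ _ ha, sw_F _ _ ha]
    refine ((Ψ_orbit hs (hψ w) (hψ w') (hp w).1 (PP _ (hp w) _ (hp w')) ?_).2 a
      ha (anc w hw a ha hra)).symm
    rw [hψp _ hw, hψp _ hw'O]
    exact (cp_same hs hw').symm
  · intro w hw w' hw'
    rw [c_cp w hw w' hw']
  · intro g hg w hw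
    rw [c_Ψ g hg w hw]
  · intro w hw i hi
    obtain ⟨N', hN', rfl⟩ := ιini (c w) i hi
    have hne : (c w).1 ≠ N'.1 := by
      intro h
      have := Subtype.ext h
      rw [← this] at hi
      exact lt_irrefl _ hi
    have hreq : rep N' = rep (c w) := congrArg Quotient.out hN'
    have him : (sw N' * (sw (c w))⁻¹) '' (c w).1 = N'.1 := by
      rw [← sw_im N', ← sw_im (c w), hreq, ← Set.image_comp]
      simp [Function.comp_def]
    have hdisj : ∀ v ∈ (c w).1, v ∉ N'.1 := fun v hv hv' =>
      hne ((Y_mem _ _ hv).2.symm.trans (Y_mem _ _ hv').2)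
    obtain ⟨g, hg, g1, g2, g3, g4⟩ := swap _ _ hne (sw N' * (sw (c w))⁻¹) (fun u hu _ => by
      rw [RelIso.mul_apply, sw_F N' _ ?_]
      · nth_rw 1 [← sw_F (c w) u hu]; simp
      · rw [equi_F (inv_mem (sw_equi _))]; exact hu) him
    have g1' : ∀ v ∈ (c w).1, g v ∈ N'.1 := by
      intro v hv
      rw [g1 v hv, ← him]; exact ⟨v, hv, rfl⟩
    have g2' : ∀ v ∈ N'.1, g v ∈ (c w).1 := by
      intro v hv
      rw [g2 v hv]
      rw [← him] at hv
      obtain ⟨n, hn, rfl⟩ := hv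
      rwa [RelIso.symm_apply_apply]
    have key : ∀ a ∈ O, (g a ∈ O ∧ r (g a) = r a) ∧ (c (g a) = c a ∨ (c a = N' ∧ c (g a) = c w) ∨
        (c a = c w ∧ c (g a) = N')) := by
      intro a ha
      by_cases h1 : a ∈ (c w).1
      · have h2 := g1' a h1
        refine ⟨⟨PO _ (Y_mem _ _ h2).1, ?_⟩, .inr (.inr ⟨c_of _ _ h1, c_of _ _ h2⟩)⟩
        rw [r_Y _ _ h1, r_Y _ _ h2, g1 a h1]; simp
      by_cases h2 : a ∈ N'.1
      · have h3 := g2' a h2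
        refine ⟨⟨PO _ (Y_mem _ _ h3).1, ?_⟩, .inr (.inl ⟨c_of _ _ h2, c_of _ _ h3⟩)⟩
        rw [r_Y _ _ h2, r_Y _ _ h3, g2 a h2]
        apply (sw (c w)).injective
        rw [RelIso.apply_inv_self]
        rw [RelIso.symm_apply_eq]; simp
      · rw [g3 a h1 h2]; exact ⟨⟨ha, rfl⟩, .inl rfl⟩
    have gO : ∀ v, v ∉ O → g v = v := fun v hv => g3 v (fun h => hv (PO _ (Y_mem _ _ h).1))
      (fun h => hv (PO _ (Y_mem _ _ h).1))
    refine ⟨g, ⟨hg, ⟨1, one_mem _, gO, fun a ha => g4 a (hO_F a ha)⟩, fun a ha => (key a ha).1⟩,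
      ?_, gO, ?_⟩
    · obtain ⟨n, hn⟩ := Y_ne (c w)
      refine ⟨n, fun h => hdisj n hn ?_⟩
      have := g1' n hn
      rwa [h] at this
    · intro a ha
      rcases (key a ha).2 with h | ⟨h, h'⟩ | ⟨h, h'⟩
      · left; rw [h]
      · right; left; rw [h, h']; exact ⟨rfl, rfl⟩
      · right; right; rw [h, h']; exact ⟨rfl, rfl⟩
  · intro v hv w hw hvw φ hφ him hι
    obtain ⟨h1, h2⟩ := p_same v hv w (hO_F w hw) hvw.symm
    have hin := inv_mem (hs.equi (hψ v))
    have e1 : s.cp (p v) = ((ψ v)⁻¹ : G ≃g G) '' s.cp v := by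
      rw [image_cp hin, ψinv v hv]
    have e2 : s.cp (p w) = ((ψ v)⁻¹ : G ≃g G) '' s.cp w := by rw [image_cp hin, h2]
    have hcc : c v = c w := by
      refine ιinj _ _ (Quotient.sound ?_) hι
      refine ⟨(ψ v)⁻¹ * φ * ψ v, fun u hu hxu => ?_, ?_⟩
      · rw [RelIso.mul_apply, RelIso.mul_apply, hφ, RelIso.inv_apply_self]
        · exact (equi_F (hs.equi (hψ v)) u).2 hu
        · have := equi_up (hs.equi (hψ v)) hu (p v)
          rw [hψp v hv] at this
          exact this.2 (((hp v).2 u hu).2 hxu)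
      · change _ '' s.cp (p v) = s.cp (p w)
        rw [e2, ← him, e1, ← Set.image_comp, ← Set.image_comp]
        congr 1
        ext n; simp
    have e3 : s.cp (p v) = s.cp (p w) := congrArg Subtype.val hcc
    rw [e1, e2] at e3
    exact (ψ v)⁻¹.injective.image_injective e3

end
end IrrCol

namespace IrrCol
variable {V : Type u} {G : SimpleGraph V}

/-- A block inside an untreated component, attached to treated vertices of type `k`. -/
structure Blk (s : Pre G) (n : V) (k : ZMod 3) (X : Set V) (par : V → V) (h : V → ℕ)
    (att : V → Set V) : Prop where
  X_cp : X ⊆ s.cp n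
  X_ne : X.Nonempty
  par_X : ∀ v ∈ X, par v ∈ X
  par_zero : ∀ v ∈ X, h v = 0 → par v = v
  par_adj : ∀ v ∈ X, h v ≠ 0 → G.Adj v (par v)
  h_par : ∀ v ∈ X, h v ≠ 0 → h v = h (par v) + 1
  base : ∀ v ∈ X, ∀ w ∈ X, h v = 0 → h w = 0 → v = w
  att_up : ∀ v ∈ X, ∀ a ∈ att v, a ∈ s.F ∧ n ∈ s.up a ∧ G.Adj a v ∧ s.τ a = k
  att_uniq : ∀ v ∈ X, ∀ w ∈ X, ∀ c, c ∈ att v → c ∈ att w → v = w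
  cofinal : ∀ a ∈ s.F, n ∈ s.up a → ∃ a' ∈ s.F, a' ∈ s.up a ∧ ∃ b ∈ X, a' ∈ att b
  sp : ∀ v ∈ X, ∀ w ∈ X, (¬ ∃ a ∈ X, (att a).Nonempty ∧ ∃ m : ℕ, par^[m] a = v) →
    (¬ ∃ a ∈ X, (att a).Nonempty ∧ ∃ m : ℕ, par^[m] a = w) → v = w
  vis : ∀ v ∈ X, ∀ b ∈ s.cp n, b ≠ v → h v ≠ 0 ∨ ∃ c ∈ X, h c ≠ 0 ∧ par c = v

section
variable {x y z : V} {s : Pre G} (hs : Good x y z s)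
include hs

theorem exists_adj_cp {n : V} (hn : n ∉ s.F) {a : V} (ha : a ∈ s.F) (hna : n ∈ s.up a) :
    ∃ u ∈ s.F, u ∈ s.up a ∧ n ∈ s.up u ∧ ∃ v ∈ s.cp n, G.Adj u v := by
  by_contra hcon
  have := hs.conn a ha (s.cp n) (fun b hb => (cp_same hs hb a ha).2 hna) ⟨n, cp_self s n⟩ ?_
  · exact cp_off hn (this (hs.self a ha)) ha
  · intro b hb c hc hbc
    rcases cp_nbr hs hn hb hbc with h | h
    · exact h
    · exact absurd ⟨c, h.1, hc, h.2, b, hb, hbc.symm⟩ hcon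

theorem exists_type {n : V} (hn : n ∉ s.F) :
    ∃ k : ZMod 3, ∀ a ∈ s.F, n ∈ s.up a →
      ∃ u ∈ s.F, u ∈ s.up a ∧ n ∈ s.up u ∧ s.τ u = k ∧ ∃ v ∈ s.cp n, G.Adj u v := by
  by_contra hcon
  push Not at hcon
  choose a ha hna hno using hcon
  have key : ∀ b ∈ s.F, n ∈ s.up b → ∀ c ∈ s.F, n ∈ s.up c →
      ∃ d ∈ s.F, n ∈ s.up d ∧ s.up d ⊆ s.up b ∧ s.up d ⊆ s.up c := by
    intro b hb hnb c hc hnc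
    rcases hs.comp b hb c hc n hnb hnc with h | h
    · exact ⟨c, hc, hnc, hs.trans b hb c hc h, subset_rfl⟩
    · exact ⟨b, hb, hnb, subset_rfl, hs.trans c hc b hb h⟩
  obtain ⟨d, hd, hnd, d0, d1⟩ := key _ (ha 0) (hna 0) _ (ha 1) (hna 1)
  obtain ⟨e, he, hne, ed, e2⟩ := key d hd hnd _ (ha 2) (hna 2)
  obtain ⟨u, hu, hue, hnu, v, hv, huv⟩ := exists_adj_cp hs hn he hne
  have hall : ∀ k, u ∈ s.up (a k) := by
    intro k
    fin_cases k
    · exact d0 (ed hue)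
    · exact d1 (ed hue)
    · exact e2 hue
  exact hno (s.τ u) u hu (hall _) hnu rfl v hv huv

theorem exists_blk {n : V} (hn : n ∉ s.F) : ∃ k X par h att, Blk s n k X par h att := by
  classical
  obtain ⟨k, hk⟩ := exists_type hs hn
  let B : Set V := {u | u ∈ s.F ∧ n ∈ s.up u ∧ s.τ u = k ∧ ∃ v ∈ s.cp n, G.Adj u v}
  have hz : ∀ u, ∃ v, u ∈ B → v ∈ s.cp n ∧ G.Adj u v := by
    intro u
    by_cases hu : u ∈ B
    · obtain ⟨v, hv⟩ := hu.2.2.2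
      exact ⟨v, fun _ => hv⟩
    · exact ⟨u, fun h => absurd h hu⟩
  choose ζ hζ using hz
  obtain ⟨u₀, hu₀⟩ : B.Nonempty := by
    obtain ⟨u, h1, -, h2, h3, h4⟩ := hk y hs.yF (by rw [hs.up_y]; trivial)
    exact ⟨u, h1, h2, h3, h4⟩
  obtain ⟨z₀, hz₀⟩ : ∃ z₀, z₀ = ζ u₀ := ⟨_, rfl⟩
  have hz₀N : z₀ ∈ s.cp n := hz₀ ▸ (hζ u₀ hu₀).1
  have hreach : ∀ v ∈ s.cp n, s.off.Reachable v z₀ := fun v hv =>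
    (SimpleGraph.Reachable.symm hv).trans hz₀N
  have hd0 : ∀ v ∈ s.cp n, s.off.dist v z₀ = 0 → v = z₀ := fun v hv h =>
    (hreach v hv).dist_eq_zero_iff.1 h
  have hstep : ∀ v, ∃ w, v ∈ s.cp n → s.off.dist v z₀ ≠ 0 →
      s.off.Adj v w ∧ s.off.dist v z₀ = s.off.dist w z₀ + 1 := by
    intro v
    by_cases h : v ∈ s.cp n ∧ s.off.dist v z₀ ≠ 0
    · obtain ⟨p, hp⟩ := (hreach v h.1).exists_walk_length_eq_dist
      cases p with
      | nil => exact absurd hp.symm h.2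
      | cons ha p =>
        rename_i w
        refine ⟨w, fun _ _ => ⟨ha, ?_⟩⟩
        rw [SimpleGraph.Walk.length_cons] at hp
        have h1 := SimpleGraph.dist_le p
        obtain ⟨q, hq⟩ := SimpleGraph.Reachable.exists_walk_length_eq_dist (G := s.off) ⟨p⟩
        have h2 := SimpleGraph.dist_le (SimpleGraph.Walk.cons ha q)
        rw [SimpleGraph.Walk.length_cons] at h2
        omega
    · exact ⟨v, fun h1 h2 => absurd ⟨h1, h2⟩ h⟩
  choose nx hnx using hstep
  obtain ⟨h, hh⟩ : ∃ h : V → ℕ, ∀ v, h v = s.off.dist v z₀ := ⟨_, fun _ => rfl⟩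
  simp only [← hh] at hd0 hnx
  have hz₀0 : h z₀ = 0 := by rw [hh, SimpleGraph.dist_self]
  let par : V → V := fun v => if h v = 0 then v else nx v
  have par0 : ∀ v, h v = 0 → par v = v := fun v hv => if_pos hv
  have par1 : ∀ v, h v ≠ 0 → par v = nx v := fun v hv => if_neg hv
  have parN : ∀ v ∈ s.cp n, par v ∈ s.cp n := by
    intro v hv
    by_cases h0 : h v = 0
    · rwa [par0 v h0]
    · rw [par1 v h0]
      exact SimpleGraph.Reachable.trans hv (hnx v hv h0).1.reachable
  have hy : ∃ y₀ ∈ s.cp n, par y₀ = z₀ ∧ (∀ b ∈ s.cp n, b ≠ z₀ → h y₀ ≠ 0) := by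
    by_cases hb : ∃ b ∈ s.cp n, b ≠ z₀
    · obtain ⟨b, hb, hbz⟩ := hb
      obtain ⟨p⟩ := (hreach b hb).symm
      cases p with
      | nil => exact absurd rfl hbz
      | cons ha p =>
        rename_i w
        have hwN : w ∈ s.cp n := SimpleGraph.Reachable.trans hz₀N ha.reachable
        have hw0 : h w ≠ 0 := fun h0 => ha.ne (hd0 w hwN h0).symm
        have hw1 : h w ≤ 1 := by
          rw [hh]
          simpa using SimpleGraph.dist_le (SimpleGraph.Walk.cons ha.symm SimpleGraph.Walk.nil)
        refine ⟨w, hwN, ?_, fun _ _ _ => hw0⟩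
        refine hd0 _ (parN w hwN) ?_
        have := (hnx w hwN hw0).2
        rw [par1 w hw0]; omega
    · exact ⟨z₀, hz₀N, par0 z₀ hz₀0, fun b hb' hbz => absurd ⟨b, hb', hbz⟩ hb⟩
  obtain ⟨y₀, hy₀N, hy₀p, hy₀⟩ := hy
  let X : Set V := {v | (∃ u ∈ B, ∃ m : ℕ, par^[m] (ζ u) = v) ∨ v = y₀}
  have itN : ∀ u ∈ B, ∀ m : ℕ, par^[m] (ζ u) ∈ s.cp n := by
    intro u hu m
    induction m with
    | zero => exact (hζ u hu).1
    | succ m ih => rw [Function.iterate_succ_apply']; exact parN _ ih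
  have XN : X ⊆ s.cp n := by
    rintro v (⟨u, hu, m, rfl⟩ | rfl)
    · exact itN u hu m
    · exact hy₀N
  have ζX : ∀ u ∈ B, ζ u ∈ X := fun u hu => .inl ⟨u, hu, 0, rfl⟩
  have hsp : ∀ v ∈ X, (¬ ∃ a ∈ X, {u | u ∈ B ∧ ζ u = a}.Nonempty ∧ ∃ m : ℕ, par^[m] a = v) →
      v = y₀ := by
    rintro v (⟨u, hu, m, rfl⟩ | rfl) hv
    · exact absurd ⟨ζ u, ζX u hu, ⟨u, hu, rfl⟩, m, rfl⟩ hv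
    · rfl
  refine ⟨k, X, par, h, fun v => {u | u ∈ B ∧ ζ u = v}, XN, ⟨_, ζX u₀ hu₀⟩, ?_,
    fun v _ => par0 v, ?_, ?_, ?_, ?_, ?_, ?_, ?_, ?_⟩
  · rintro v (⟨u, hu, m, rfl⟩ | rfl)
    · exact .inl ⟨u, hu, m + 1, Function.iterate_succ_apply' ..⟩
    · rw [hy₀p, hz₀]; exact ζX u₀ hu₀
  · intro v hv h0
    rw [par1 v h0]; exact (hnx v (XN hv) h0).1.1
  · intro v hv h0
    rw [par1 v h0]; exact (hnx v (XN hv) h0).2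
  · intro v hv w hw h1 h2
    rw [hd0 v (XN hv) h1, hd0 w (XN hw) h2]
  · rintro v hv a ⟨ha, rfl⟩
    exact ⟨ha.1, ha.2.1, (hζ a ha).2, ha.2.2.1⟩
  · rintro v - w - c ⟨-, rfl⟩ ⟨-, rfl⟩; rfl
  · intro a ha hna
    obtain ⟨u, h1, h2, h3, h4, h5⟩ := hk a ha hna
    exact ⟨u, h1, h2, ζ u, ζX u ⟨h1, h3, h4, h5⟩, ⟨h1, h3, h4, h5⟩, rfl⟩
  · intro v hv w hw h1 h2
    rw [hsp v hv h1, hsp w hw h2]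
  · intro v hv b hb hbv
    by_cases h0 : h v = 0
    · right
      have := hd0 v (XN hv) h0
      subst this
      exact ⟨y₀, .inr rfl, hy₀ b hb hbv, hy₀p⟩
    · exact .inl h0

end
end IrrCol

namespace IrrCol
variable {V : Type u} {G : SimpleGraph V}

/-- The data of a block inside a component. -/
structure BlkData (V : Type u) where
  k : ZMod 3
  X : Set V
  par : V → V
  h : V → ℕ
  att : V → Set V

/-- The validity of the data of a block for the component of `n`. -/
abbrev BlkData.Valid (D : BlkData V) (s : Pre G) (n : V) : Prop :=
  Blk s n D.k D.X D.par D.h D.att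

open Classical in
/-- Adding the transported blocks to all components of an orbit. -/
noncomputable def Pre.step (s : Pre G) (O : Set V) (r : V → V) (κ : V → G ≃g G)
    (ι : V → Ordinal.{u}) (Ψ' : Subgroup (G ≃g G)) (D : V → BlkData V) (ρ : Ordinal.{u}) :
    Pre G where
  F := s.F ∪ {w | w ∈ O ∧ r w ∈ (D (r w)).X}
  up w := if w ∈ O then s.cp w else s.up w
  par w := if w ∈ O then κ w ((D (r w)).par (r w)) else s.par w
  h w := if w ∈ O then (D (r w)).h (r w) else s.h w
  att w := if w ∈ O then κ w '' (D (r w)).att (r w) else s.att w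
  τ w := if w ∈ O then (D (r w)).k + 1 else s.τ w
  rk w := if w ∈ O then ρ else s.rk w
  idx w := if w ∈ O then ι w else s.idx w
  Ψ := Ψ'

theorem exists_coherent_blk {x y z : V} {s : Pre G} (hs : Good x y z s) :
    ∃ D : V → BlkData V, (∀ n, n ∉ s.F → (D n).Valid s n) ∧
      ∀ n n', n' ∈ s.cp n → D n' = D n := by
  classical
  have h1 : ∀ n, ∃ D : BlkData V, n ∉ s.F → D.Valid s n := by
    intro n
    by_cases hn : n ∈ s.F
    · exact ⟨⟨0, ∅, id, fun _ => 0, fun _ => ∅⟩, fun h => absurd hn h⟩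
    · obtain ⟨k, X, par, h, att, hb⟩ := exists_blk hs hn
      exact ⟨⟨k, X, par, h, att⟩, fun _ => hb⟩
  choose D hD using h1
  have h2 : ∀ n, ∃ m, m ∈ s.cp n := fun n => ⟨n, cp_self s n⟩
  let ε : Set V → V := fun S => if h : S.Nonempty then h.some else x
  have hε : ∀ n, ε (s.cp n) ∈ s.cp n := by
    intro n
    have : (s.cp n).Nonempty := h2 n
    simp only [ε, dif_pos this]
    exact this.some_mem
  refine ⟨fun n => D (ε (s.cp n)), ?_, ?_⟩
  · intro n hn
    have hm := hε n
    have hmF := cp_off hn hm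
    have hb := hD _ hmF
    have hc : s.cp (ε (s.cp n)) = s.cp n := cp_eq hm
    have hsame := cp_same hs hm
    exact ⟨hb.X_cp.trans hc.subset, hb.X_ne, hb.par_X, hb.par_zero, hb.par_adj, hb.h_par, hb.base,
      fun v hv a ha => by
        obtain ⟨p1, p2, p3, p4⟩ := hb.att_up v hv a ha
        exact ⟨p1, (hsame a p1).1 p2, p3, p4⟩,
      hb.att_uniq, fun a ha hna => hb.cofinal a ha ((hsame a ha).2 hna), hb.sp,
      fun v hv b hb' => hb.vis v hv b (by rw [hc]; exact hb')⟩
  · intro n n' h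
    simp only [cp_eq h]

section
variable {x y z : V} {s : Pre G} (hs : Good x y z s)
variable {O : Set V} {r : V → V} {κ : V → G ≃g G} {ι : V → Ordinal.{u}} {Ψ' : Subgroup (G ≃g G)}
variable (hc : IsChart s O r κ ι Ψ') {D : V → BlkData V} {ρ : Ordinal.{u}}

include hc in
theorem step_ext : Ext s (s.step O r κ ι Ψ' D ρ) := by
  refine ⟨Set.subset_union_left, hc.le, fun v hv => ?_, fun ψ hψ v hv hvF => ?_⟩
  · have : v ∉ O := fun h => hc.O_F v h hv
    simp [Pre.step, this]
  · rcases hv with hv | ⟨hv, -⟩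
    · exact absurd hv hvF
    · have := hc.map_O ψ (hc.le hψ) v hv
      simp only [Pre.step, if_pos hv, if_pos this]
      exact hc.ι_Ψ ψ hψ v hv

include hs hc in
theorem step_good (hD : ∀ n, n ∉ s.F → (D n).Valid s n)
    (hD' : ∀ n n', n' ∈ s.cp n → D n' = D n) (hρ : ∀ a ∈ s.F, s.rk a < ρ) :
    Good x y z (s.step O r κ ι Ψ' D ρ) := by
  obtain ⟨t, ht⟩ : ∃ t, t = s.step O r κ ι Ψ' D ρ := ⟨_, rfl⟩
  have hext : Ext s t := ht ▸ step_ext hc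
  obtain ⟨Q, hQ⟩ : ∃ Q : Set V, Q = {w | w ∈ O ∧ r w ∈ (D (r w)).X} := ⟨_, rfl⟩
  have tF : ∀ v, v ∈ t.F ↔ v ∈ s.F ∨ v ∈ Q := by rintro v; rw [ht, hQ]; exact Iff.rfl
  have QO : ∀ w ∈ Q, w ∈ O := by rintro w hw; rw [hQ] at hw; exact hw.1
  have QX : ∀ w ∈ Q, r w ∈ (D (r w)).X := by rintro w hw; rw [hQ] at hw; exact hw.2
  have QF : ∀ w ∈ Q, w ∉ s.F := fun w hw => hc.O_F w (QO w hw)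
  have t_up : ∀ w ∈ O, t.up w = s.cp w := fun w hw => by rw [ht]; exact if_pos hw
  have t_par : ∀ w ∈ O, t.par w = κ w ((D (r w)).par (r w)) := fun w hw => by
    rw [ht]; exact if_pos hw
  have t_h : ∀ w ∈ O, t.h w = (D (r w)).h (r w) := fun w hw => by rw [ht]; exact if_pos hw
  have t_att : ∀ w ∈ O, t.att w = κ w '' (D (r w)).att (r w) := fun w hw => by
    rw [ht]; exact if_pos hw
  have t_τ : ∀ w ∈ O, t.τ w = (D (r w)).k + 1 := fun w hw => by rw [ht]; exact if_pos hw
  have t_rk : ∀ w ∈ O, t.rk w = ρ := fun w hw => by rw [ht]; exact if_pos hw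
  have t_idx : ∀ w ∈ O, t.idx w = ι w := fun w hw => by rw [ht]; exact if_pos hw
  have t_Ψ : t.Ψ = Ψ' := by rw [ht]; rfl
  rw [← ht]
  clear ht
  have o_up : ∀ w ∈ s.F, t.up w = s.up w := fun w hw => (hext.2.2.1 w hw).1
  have o_par : ∀ w ∈ s.F, t.par w = s.par w := fun w hw => (hext.2.2.1 w hw).2.1
  have o_h : ∀ w ∈ s.F, t.h w = s.h w := fun w hw => (hext.2.2.1 w hw).2.2.1
  have o_att : ∀ w ∈ s.F, t.att w = s.att w := fun w hw => (hext.2.2.1 w hw).2.2.2.1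
  have o_τ : ∀ w ∈ s.F, t.τ w = s.τ w := fun w hw => (hext.2.2.1 w hw).2.2.2.2.1
  have o_rk : ∀ w ∈ s.F, t.rk w = s.rk w := fun w hw => (hext.2.2.1 w hw).2.2.2.2.2.1
  have o_idx : ∀ w ∈ s.F, t.idx w = s.idx w := fun w hw => (hext.2.2.1 w hw).2.2.2.2.2.2
  have FO : ∀ w ∈ s.F, w ∉ O := fun w hw h => hc.O_F w h hw
  have Ft : ∀ w ∈ s.F, w ∈ t.F := fun w hw => (tF w).2 (.inl hw)
  have Qt : ∀ w ∈ Q, w ∈ t.F := fun w hw => (tF w).2 (.inr hw)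
  have O_cp : ∀ w ∈ O, ∀ w' ∈ s.cp w, w' ∈ O := fun w hw w' hw' =>
    hc.O_cl w hw w' (cp_off (hc.O_F w hw) hw') (cp_same hs hw')
  have r_cp : ∀ w ∈ O, ∀ w' ∈ s.cp w, r w' ∈ s.cp (r w) ∧ κ w (r w') = w' := by
    intro w hw w' hw'
    have h1 : (κ w)⁻¹ w' ∈ s.cp (r w) := by
      rw [← equi_cp (hc.κ_equi w hw), RelIso.apply_inv_self, hc.κ_r w hw]; exact hw'
    have h2 := hc.r_κ w hw _ h1
    rw [RelIso.apply_inv_self] at h2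
    rw [h2]
    exact ⟨h1, RelIso.apply_inv_self _ _⟩
  have κ_mem : ∀ w ∈ O, ∀ n ∈ s.cp (r w), κ w n ∈ s.cp w := by
    intro w hw n hn
    have := (equi_cp (hc.κ_equi w hw) (r w) n).2 hn
    rwa [hc.κ_r w hw] at this
  have D_cp : ∀ w ∈ O, ∀ w' ∈ s.cp w, D (r w') = D (r w) := fun w hw w' hw' =>
    hD' _ _ (r_cp w hw w' hw').1
  have κ_coh : ∀ w ∈ O, ∀ w' ∈ s.cp w, ∀ n ∈ s.cp (r w), κ w' n = κ w n := by
    intro w hw w' hw' n hn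
    have hw'O := O_cp w hw w' hw'
    have hn' : n ∈ s.cp (r w') := by rw [cp_eq (r_cp w hw w' hw').1]; exact hn
    have h1 := κ_mem w hw n hn
    have h2 := κ_mem w' hw'O n hn'
    rw [cp_eq hw', ← cp_eq h1] at h2
    refine hc.r_inj _ (O_cp w hw _ h1) _ h2 ?_
    rw [hc.r_κ w hw n hn, hc.r_κ w' hw'O n hn']
  have κ_g : ∀ g ∈ Ψ', ∀ w ∈ O, ∀ n ∈ s.cp (r w), κ (g w) n = g (κ w n) := by
    intro g hg w hw n hn
    have hgw := hc.map_O g hg w hw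
    have hn' : n ∈ s.cp (r (g w)) := by rw [hc.r_map g hg w hw]; exact hn
    have h1 := κ_mem w hw n hn
    have h2 := κ_mem _ hgw n hn'
    have h3 := (equi_cp (hc.equi hg) _ _).2 h1
    rw [← cp_eq h3] at h2
    refine hc.r_inj _ (O_cp _ hgw _ h3) _ h2 ?_
    rw [hc.r_κ _ hgw n hn', hc.r_map g hg _ (O_cp w hw _ h1), hc.r_κ w hw n hn]
  have val : ∀ w ∈ O, (D (r w)).Valid s (r w) := fun w hw => hD _ (hc.O_F _ (hc.r_O w hw))
  have κQ : ∀ w ∈ O, ∀ n ∈ (D (r w)).X, κ w n ∈ Q ∧ κ w n ∈ s.cp w ∧ r (κ w n) = n ∧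
      D (r (κ w n)) = D (r w) := by
    intro w hw n hn
    have h0 := (val w hw).X_cp hn
    have h1 := κ_mem w hw n h0
    have h2 := hc.r_κ w hw n h0
    have h3 := D_cp w hw _ h1
    refine ⟨?_, h1, h2, h3⟩
    rw [hQ]
    refine ⟨O_cp w hw _ h1, ?_⟩
    rw [h3, h2]; exact hn
  have κF : ∀ w ∈ O, ∀ a, κ w a ∈ s.F ↔ a ∈ s.F := fun w hw a => equi_F (hc.κ_equi w hw) a
  have κ_up : ∀ w ∈ O, ∀ a ∈ s.F, w ∈ s.up (κ w a) ↔ r w ∈ s.up a := by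
    intro w hw a ha
    have := equi_up (hc.κ_equi w hw) ha (r w)
    rwa [hc.κ_r w hw] at this
  have ltFF : ∀ a ∈ s.F, ∀ b ∈ s.F, t.lt a b ↔ s.lt a b := by
    intro a ha b hb
    simp only [Pre.lt, o_up a ha, o_up b hb]
  have eqvFF : ∀ a ∈ s.F, ∀ b ∈ s.F, t.eqv a b ↔ s.eqv a b := by
    intro a ha b hb
    simp only [Pre.eqv, o_up a ha, o_up b hb]
  have ltFQ : ∀ a ∈ s.F, ∀ b ∈ Q, t.lt a b ↔ b ∈ s.up a := by
    intro a ha b hb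
    simp only [Pre.lt, o_up a ha, t_up b (QO b hb)]
    exact ⟨fun h => h.1, fun h => ⟨h, fun h' => cp_off (QF b hb) h' ha⟩⟩
  have upQF : ∀ a ∈ Q, ∀ b ∈ s.F, b ∉ t.up a := by
    intro a ha b hb h
    rw [t_up a (QO a ha)] at h
    exact cp_off (QF a ha) h hb
  have cp_symm : ∀ a b, b ∈ s.cp a → a ∈ s.cp b := fun a b h => by
    rw [cp_eq h]; exact cp_self s a
  have ltQ : ∀ a ∈ Q, ∀ b ∈ t.F, ¬ t.lt a b := by
    intro a ha b hb h
    rcases (tF b).1 hb with hb | hb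
    · exact upQF a ha b hb h.1
    · rw [Pre.lt, t_up a (QO a ha), t_up b (QO b hb)] at h
      exact h.2 (cp_symm _ _ h.1)
  have eqvQQ : ∀ a ∈ Q, ∀ b ∈ Q, t.eqv a b ↔ b ∈ s.cp a := by
    intro a ha b hb
    simp only [Pre.eqv, t_up a (QO a ha), t_up b (QO b hb)]
    exact ⟨fun h => h.1, fun h => ⟨h, cp_symm _ _ h⟩⟩
  have eqvFQ : ∀ a ∈ s.F, ∀ b ∈ Q, ¬ t.eqv a b := fun a ha b hb h => upQF b hb a ha h.2
  have eqvQF : ∀ a ∈ Q, ∀ b ∈ s.F, ¬ t.eqv a b := fun a ha b hb h => upQF a ha b hb h.1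
  have eqv_cases : ∀ a ∈ t.F, ∀ b ∈ t.F, t.eqv a b → (a ∈ s.F ∧ b ∈ s.F ∧ s.eqv a b) ∨
      (a ∈ Q ∧ b ∈ Q ∧ b ∈ s.cp a) := by
    intro a ha b hb h
    rcases (tF a).1 ha with ha | ha <;> rcases (tF b).1 hb with hb | hb
    · exact .inl ⟨ha, hb, (eqvFF a ha b hb).1 h⟩
    · exact absurd h (eqvFQ a ha b hb)
    · exact absurd h (eqvQF a ha b hb)
    · exact .inr ⟨ha, hb, (eqvQQ a ha b hb).1 h⟩
  have parQ : ∀ w ∈ O, ∀ n ∈ (D (r w)).X, t.par (κ w n) = κ w ((D (r w)).par n) := by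
    intro w hw n hn
    obtain ⟨h1, h2, h3, h4⟩ := κQ w hw n hn
    rw [t_par _ (QO _ h1), h4, h3]
    exact κ_coh w hw _ h2 _ ((val w hw).X_cp ((val w hw).par_X n hn))
  have attQ : ∀ w ∈ O, ∀ n ∈ (D (r w)).X, ∀ a ∈ (D (r w)).att n, κ w a ∈ t.att (κ w n) := by
    intro w hw n hn a ha
    obtain ⟨h1, h2, h3, h4⟩ := κQ w hw n hn
    obtain ⟨p1, p2, -⟩ := (val w hw).att_up n hn a ha
    rw [t_att _ (QO _ h1), h4, h3]
    exact ⟨a, ha, hc.κ_cp w hw _ h2 a p1 p2⟩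
  have SpF : ∀ a ∈ s.F, s.Sp a → t.Sp a := by
    rintro a ha ⟨b, hb, hba, hatt, n, hn⟩
    refine ⟨b, Ft b hb, (eqvFF b hb a ha).2 hba, by rw [o_att b hb]; exact hatt, n, ?_⟩
    have : ∀ m : ℕ, t.par^[m] b = s.par^[m] b ∧ s.par^[m] b ∈ s.F := by
      intro m
      induction m with
      | zero => exact ⟨rfl, hb⟩
      | succ m ih =>
        rw [Function.iterate_succ_apply', Function.iterate_succ_apply', ih.1]
        exact ⟨o_par _ ih.2, hs.par_F _ ih.2⟩
    rw [(this n).1, hn]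
  have SpQ : ∀ w ∈ Q, (∃ a ∈ (D (r w)).X, ((D (r w)).att a).Nonempty ∧
      ∃ m : ℕ, (D (r w)).par^[m] a = r w) → t.Sp w := by
    rintro w hw ⟨a, ha, ⟨u, hu⟩, m, hm⟩
    have hwO := QO w hw
    obtain ⟨h1, h2, h3, h4⟩ := κQ w hwO a ha
    refine ⟨κ w a, Qt _ h1, (eqvQQ _ h1 w hw).2 (cp_symm _ _ h2), ⟨_, attQ w hwO a ha u hu⟩, m, ?_⟩
    have : ∀ m : ℕ, t.par^[m] (κ w a) = κ w ((D (r w)).par^[m] a) ∧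
        (D (r w)).par^[m] a ∈ (D (r w)).X := by
      intro m
      induction m with
      | zero => exact ⟨rfl, ha⟩
      | succ m ih =>
        rw [Function.iterate_succ_apply', Function.iterate_succ_apply', ih.1]
        exact ⟨parQ w hwO _ ih.2, (val w hwO).par_X _ ih.2⟩
    rw [(this m).1, hm, hc.κ_r w hwO]
  have gO : ∀ g ∈ Ψ', ∀ w, g w ∈ O ↔ w ∈ O := by
    intro g hg w
    refine ⟨fun h => ?_, hc.map_O g hg w⟩
    have := hc.map_O _ (inv_mem hg) _ h
    simpa using this
  have gQ : ∀ g ∈ Ψ', ∀ w, g w ∈ Q ↔ w ∈ Q := by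
    intro g hg w
    rw [hQ]
    simp only [Set.mem_ofPred_eq, gO g hg]
    refine and_congr_right fun hw => ?_
    rw [hc.r_map g hg w hw]
  refine
    { self := ?self, trans := ?trans, comp := ?comp, rk := ?rk, nbr := ?nbr, conn := ?conn,
      par_F := ?par_F, par_eqv := ?par_eqv, par_zero := ?par_zero, par_adj := ?par_adj,
      h_par := ?h_par, base := ?base, att_F := ?att_F, att_lt := ?att_lt, att_adj := ?att_adj,
      att_τ := ?att_τ, att_uniq := ?att_uniq, cofinal := ?cofinal, sp := ?sp, τ_eqv := ?τ_eqv,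
      idx_eqv := ?idx_eqv, vis := ?vis, semi := ?semi, equi := ?equi, cert := ?cert,
      twin := ?twin, lim := ?lim, xF := Ft _ hs.xF, yF := Ft _ hs.yF, zF := Ft _ hs.zF,
      up_y := by rw [o_up _ hs.yF, hs.up_y], nonroot := ?nonroot,
      h_y := by rw [o_h _ hs.yF, hs.h_y], h_x := by rw [o_h _ hs.xF, hs.h_x],
      h_z := by rw [o_h _ hs.zF, hs.h_z], par_x := by rw [o_par _ hs.xF, hs.par_x],
      par_z := by rw [o_par _ hs.zF, hs.par_z], fix := ?fix }
  case self =>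
    intro v hv
    rcases (tF v).1 hv with hv | hv
    · rw [o_up v hv]; exact hs.self v hv
    · rw [t_up v (QO v hv)]; exact cp_self s v
  case trans =>
    intro a ha b hb hba
    rcases (tF a).1 ha with ha | ha <;> rcases (tF b).1 hb with hb | hb
    · rw [o_up a ha] at *
      rw [o_up b hb]
      exact hs.trans a ha b hb hba
    · rw [o_up a ha] at *
      rw [t_up b (QO b hb)]
      exact fun c hcb => (cp_same hs hcb a ha).2 hba
    · exact absurd hba (upQF a ha b hb)
    · rw [t_up a (QO a ha)] at *
      rw [t_up b (QO b hb), cp_eq hba]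
  case comp =>
    intro a ha b hb c hca hcb
    rcases (tF a).1 ha with ha | ha <;> rcases (tF b).1 hb with hb | hb
    · rw [o_up a ha, o_up b hb] at *
      exact hs.comp a ha b hb c hca hcb
    · rw [o_up a ha, t_up b (QO b hb)] at *
      exact .inl ((cp_same hs hcb a ha).1 hca)
    · rw [o_up b hb, t_up a (QO a ha)] at *
      exact .inr ((cp_same hs hca b hb).1 hcb)
    · rw [t_up a (QO a ha), t_up b (QO b hb)] at *
      left
      rw [← cp_eq hca, cp_eq hcb]; exact cp_self s b
  case rk =>
    intro a ha b hb hab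
    rcases (tF a).1 ha with ha | ha
    · rcases (tF b).1 hb with hb | hb
      · rw [o_rk a ha, o_rk b hb]
        exact hs.rk a ha b hb ((ltFF a ha b hb).1 hab)
      · rw [o_rk a ha, t_rk b (QO b hb)]; exact hρ a ha
    · exact absurd hab (ltQ a ha b hb)
  case nbr =>
    intro a ha b hb c hbc
    rcases (tF a).1 ha with ha | ha
    · rw [o_up a ha] at *
      rcases hs.nbr a ha b hb c hbc with h | h
      · exact .inl h
      · exact .inr ⟨Ft _ h.1, by rw [o_up c h.1]; exact h.2⟩
    · rw [t_up a (QO a ha)] at *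
      rcases cp_nbr hs (QF a ha) hb hbc with h | h
      · exact .inl h
      · exact .inr ⟨Ft _ h.1, by rw [o_up c h.1]; exact h.2⟩
  case conn =>
    intro a ha
    rcases (tF a).1 ha with ha | ha
    · rw [o_up a ha]; exact hs.conn a ha
    · rw [t_up a (QO a ha)]; exact conn_cp _ _
  case par_F =>
    intro v hv
    rcases (tF v).1 hv with hv | hv
    · rw [o_par v hv]; exact Ft _ (hs.par_F v hv)
    · rw [t_par v (QO v hv)]
      exact Qt _ (κQ v (QO v hv) _ ((val v (QO v hv)).par_X _ (QX v hv))).1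
  case par_eqv =>
    intro v hv
    rcases (tF v).1 hv with hv | hv
    · rw [o_par v hv, eqvFF v hv _ (hs.par_F v hv)]; exact hs.par_eqv v hv
    · rw [t_par v (QO v hv)]
      have := κQ v (QO v hv) _ ((val v (QO v hv)).par_X _ (QX v hv))
      exact (eqvQQ v hv _ this.1).2 this.2.1
  case par_zero =>
    intro v hv h0
    rcases (tF v).1 hv with hv | hv
    · rw [o_h v hv] at h0; rw [o_par v hv]; exact hs.par_zero v hv h0
    · rw [t_h v (QO v hv)] at h0
      rw [t_par v (QO v hv), (val v (QO v hv)).par_zero _ (QX v hv) h0, hc.κ_r v (QO v hv)]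
  case par_adj =>
    intro v hv h0
    rcases (tF v).1 hv with hv | hv
    · rw [o_h v hv] at h0; rw [o_par v hv]; exact hs.par_adj v hv h0
    · rw [t_h v (QO v hv)] at h0
      rw [t_par v (QO v hv)]
      have := (κ v).map_adj_iff.2 ((val v (QO v hv)).par_adj _ (QX v hv) h0)
      rwa [hc.κ_r v (QO v hv)] at this
  case h_par =>
    intro v hv h0
    rcases (tF v).1 hv with hv | hv
    · rw [o_h v hv] at *; rw [o_par v hv, o_h _ (hs.par_F v hv)]; exact hs.h_par v hv h0
    · have hvO := QO v hv
      rw [t_h v hvO] at *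
      rw [t_par v hvO]
      obtain ⟨h1, h2, h3, h4⟩ := κQ v hvO _ ((val v hvO).par_X _ (QX v hv))
      rw [t_h _ (QO _ h1), h4, h3]
      exact (val v hvO).h_par _ (QX v hv) h0
  case base =>
    intro a ha b hb hab h1 h2
    rcases eqv_cases a ha b hb hab with ⟨ha, hb, h⟩ | ⟨ha, hb, h⟩
    · rw [o_h a ha] at h1; rw [o_h b hb] at h2
      exact hs.base a ha b hb h h1 h2
    · have haO := QO a ha
      have hXb := QX b hb
      rw [t_h a haO] at h1
      rw [t_h b (QO b hb), D_cp a haO b h] at h2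
      rw [D_cp a haO b h] at hXb
      exact (hc.r_inj a haO b h ((val a haO).base _ hXb _ (QX a ha) h2 h1)).symm
  case att_F =>
    intro v hv a hav
    rcases (tF v).1 hv with hv | hv
    · rw [o_att v hv] at hav; exact Ft _ (hs.att_F v hv a hav)
    · rw [t_att v (QO v hv)] at hav
      obtain ⟨a, ha, rfl⟩ := hav
      exact Ft _ ((κF v (QO v hv) a).2 ((val v (QO v hv)).att_up _ (QX v hv) a ha).1)
  case att_lt =>
    intro v hv a hav
    rcases (tF v).1 hv with hv | hv
    · rw [o_att v hv] at hav
      rw [ltFF a (hs.att_F v hv a hav) v hv]; exact hs.att_lt v hv a hav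
    · rw [t_att v (QO v hv)] at hav
      obtain ⟨a, ha, rfl⟩ := hav
      obtain ⟨p1, p2, -⟩ := (val v (QO v hv)).att_up _ (QX v hv) a ha
      rw [ltFQ _ ((κF v (QO v hv) a).2 p1) v hv]
      exact (κ_up v (QO v hv) a p1).2 p2
  case att_adj =>
    intro v hv a hav
    rcases (tF v).1 hv with hv | hv
    · rw [o_att v hv] at hav; exact hs.att_adj v hv a hav
    · rw [t_att v (QO v hv)] at hav
      obtain ⟨a, ha, rfl⟩ := hav
      obtain ⟨-, -, p3, -⟩ := (val v (QO v hv)).att_up _ (QX v hv) a ha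
      have := (κ v).map_adj_iff.2 p3
      rwa [hc.κ_r v (QO v hv)] at this
  case att_τ =>
    intro v hv a hav
    rcases (tF v).1 hv with hv | hv
    · rw [o_att v hv] at hav
      rw [o_τ v hv, o_τ a (hs.att_F v hv a hav)]; exact hs.att_τ v hv a hav
    · rw [t_att v (QO v hv)] at hav
      obtain ⟨a, ha, rfl⟩ := hav
      obtain ⟨p1, -, -, p4⟩ := (val v (QO v hv)).att_up _ (QX v hv) a ha
      rw [t_τ v (QO v hv), o_τ _ ((κF v (QO v hv) a).2 p1),
        ((hc.κ_equi v (QO v hv) a).2 p1).2.2.2.1, p4]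
  case att_uniq =>
    intro a ha b hb hab c h1 h2
    rcases eqv_cases a ha b hb hab with ⟨ha, hb, h⟩ | ⟨ha, hb, h⟩
    · rw [o_att a ha] at h1; rw [o_att b hb] at h2
      exact hs.att_uniq a ha b hb h c h1 h2
    · have haO := QO a ha
      have hXb := QX b hb
      rw [t_att a haO] at h1
      rw [t_att b (QO b hb), D_cp a haO b h] at h2
      rw [D_cp a haO b h] at hXb
      obtain ⟨c1, hc1, rfl⟩ := h1
      obtain ⟨c2, hc2, e⟩ := h2
      obtain ⟨p1, p2, -, -⟩ := (val a haO).att_up _ hXb _ hc2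
      rw [hc.κ_cp a haO b h c2 p1 p2] at e
      have e := (κ a).injective e
      subst e
      exact (hc.r_inj a haO b h ((val a haO).att_uniq _ hXb _ (QX a ha) _ hc2 hc1)).symm
  case cofinal =>
    intro a ha b hb hab
    rcases (tF a).1 ha with ha | ha
    · rcases (tF b).1 hb with hb | hb
      · rw [ltFF a ha b hb] at hab
        obtain ⟨a', h1, h2, b', h3, h4, h5⟩ := hs.cofinal a ha b hb hab
        exact ⟨a', Ft _ h1, by rw [o_up a ha]; exact h2, b', Ft _ h3, (eqvFF b hb b' h3).2 h4,
          by rw [o_att b' h3]; exact h5⟩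
      · rw [ltFQ a ha b hb] at hab
        have hbO := QO b hb
        obtain ⟨a, rfl⟩ := (κ b).surjective a
        have ha' := (κF b hbO a).1 ha
        obtain ⟨a', h1, h2, b', h3, h4⟩ := (val b hbO).cofinal a ha' ((κ_up b hbO a ha').1 hab)
        obtain ⟨q1, q2, -⟩ := κQ b hbO b' h3
        refine ⟨κ b a', Ft _ ((κF b hbO a').2 h1), ?_, κ b b', Qt _ q1, (eqvQQ b hb _ q1).2 q2,
          attQ b hbO b' h3 a' h4⟩
        rw [o_up _ ha]
        exact (equi_up (hc.κ_equi b hbO) ha' a').2 h2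
    · exact absurd hab (ltQ a ha b hb)
  case sp =>
    intro a ha b hb hab hya h1 h2
    rcases eqv_cases a ha b hb hab with ⟨ha, hb, h⟩ | ⟨ha, hb, h⟩
    · exact hs.sp a ha b hb h ((ltFF y hs.yF a ha).1 hya) (fun h => h1 (SpF a ha h))
        (fun h => h2 (SpF b hb h))
    · have haO := QO a ha
      have hXb := QX b hb
      have h1' := fun h => h1 (SpQ a ha h)
      have h2' := fun h => h2 (SpQ b hb h)
      rw [D_cp a haO b h] at hXb h2'
      exact (hc.r_inj a haO b h ((val a haO).sp _ hXb _ (QX a ha) h2' h1')).symm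
  case τ_eqv =>
    intro a ha b hb hab
    rcases eqv_cases a ha b hb hab with ⟨ha, hb, h⟩ | ⟨ha, hb, h⟩
    · rw [o_τ a ha, o_τ b hb]; exact hs.τ_eqv a ha b hb h
    · rw [t_τ a (QO a ha), t_τ b (QO b hb), D_cp a (QO a ha) b h]
  case idx_eqv =>
    intro a ha b hb hab
    rcases eqv_cases a ha b hb hab with ⟨ha, hb, h⟩ | ⟨ha, hb, h⟩
    · rw [o_idx a ha, o_idx b hb]; exact hs.idx_eqv a ha b hb h
    · rw [t_idx a (QO a ha), t_idx b (QO b hb), hc.ι_cp a (QO a ha) b h]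
  case vis =>
    intro a ha b hb hba
    rcases (tF a).1 ha with ha | ha
    · rw [o_up a ha] at hb
      rcases hs.vis a ha b hb hba with h | ⟨c, h1, h2, h3⟩
      · left; rwa [o_h a ha]
      · right; exact ⟨c, Ft c h1, by rwa [o_h c h1], by rwa [o_par c h1]⟩
    · have haO := QO a ha
      rw [t_up a haO] at hb
      rcases (val a haO).vis (r a) (QX a ha) (r b) (r_cp a haO b hb).1
        (fun e => hba (hc.r_inj a haO b hb e)) with h | ⟨c, h1, h2, h3⟩
      · left; rwa [t_h a haO]
      · right
        obtain ⟨q1, q2, q3, q4⟩ := κQ a haO c h1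
        refine ⟨κ a c, Qt _ q1, ?_, ?_⟩
        · rwa [t_h _ (QO _ q1), q4, q3]
        · rw [parQ a haO c h1, h3, hc.κ_r a haO]
  case semi =>
    intro ψ hψ v hv hsame
    rw [t_Ψ] at hψ
    have hvF : v ∉ s.F := fun h => hv (Ft v h)
    obtain ⟨χ, hχ, h1, h2⟩ := hc.proj ψ hψ
    have hs' : s.same (ψ v) v := fun a ha => by
      have := hsame a (Ft a ha)
      rwa [o_up a ha] at this
    by_cases hvO : v ∈ O
    · obtain ⟨e1, e2⟩ := hs.semi χ hχ v hvF ((h2 v hvO).symm.trans hs')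
      obtain ⟨n, hn⟩ := (val v hvO).X_ne
      obtain ⟨q1, q2, -⟩ := κQ v hvO n hn
      have h3 : ψ v ∈ s.cp v := by
        have := hsame _ (Qt _ q1)
        rw [t_up _ (QO _ q1), cp_eq q2] at this
        exact this.2 (cp_self s v)
      have h4 := hc.r_inj v hvO _ h3 (hc.r_map ψ hψ v hvO)
      refine ⟨h4, fun a ha hva => ?_⟩
      rcases (tF a).1 ha with ha | ha
      · rw [o_up a ha] at hva
        rw [h1 a (FO a ha)]; exact e2 a ha hva
      · have haO := QO a ha
        rw [t_up a haO] at hva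
        refine hc.r_inj a haO _ ?_ (hc.r_map ψ hψ a haO)
        have := (equi_cp (hc.equi hψ) v a).2 (cp_symm _ _ hva)
        rw [h4] at this
        rwa [← cp_eq hva]
    · obtain ⟨e1, e2⟩ := hs.semi χ hχ v hvF (by rw [← h1 v hvO]; exact hs')
      refine ⟨by rw [h1 v hvO, e1], fun a ha hva => ?_⟩
      rcases (tF a).1 ha with ha | ha
      · rw [o_up a ha] at hva
        rw [h1 a (FO a ha)]; exact e2 a ha hva
      · rw [t_up a (QO a ha)] at hva
        exact absurd (O_cp a (QO a ha) v hva) hvO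
  case equi =>
    intro g hg v
    rw [t_Ψ] at hg
    have hge := hc.equi hg
    refine ⟨by rw [tF, tF, equi_F hge, gQ g hg], fun hv => ?_⟩
    rcases (tF v).1 hv with hv | hv
    · have hgv := (equi_F hge v).2 hv
      rw [o_up _ hgv, o_par _ hgv, o_h _ hgv, o_att _ hgv, o_τ _ hgv, o_up _ hv, o_par _ hv,
        o_h _ hv, o_att _ hv, o_τ _ hv]
      exact (hge v).2 hv
    · have hvO := QO v hv
      have hgv := hc.map_O g hg v hvO
      have hr := hc.r_map g hg v hvO
      rw [t_up _ hgv, t_par _ hgv, t_h _ hgv, t_att _ hgv, t_τ _ hgv, t_up _ hvO, t_par _ hvO,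
        t_h _ hvO, t_att _ hvO, t_τ _ hvO, hr]
      refine ⟨fun a => equi_cp hge v a, ?_, rfl, rfl, fun a => ?_⟩
      · exact κ_g g hg v hvO _ ((val v hvO).X_cp ((val v hvO).par_X _ (QX v hv)))
      · have key : ∀ c ∈ (D (r v)).att (r v), κ (g v) c = g (κ v c) := by
          intro c hcc
          obtain ⟨p1, p2, -⟩ := (val v hvO).att_up _ (QX v hv) c hcc
          exact hc.κ_F v hvO g hg c p1 p2
        constructor
        · rintro ⟨c, hcc, e⟩
          rw [key c hcc] at e
          exact ⟨c, hcc, g.injective e⟩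
        · rintro ⟨c, hcc, rfl⟩
          exact ⟨c, hcc, key c hcc⟩
  case cert =>
    intro v hv i hi
    rw [t_Ψ]
    rcases (tF v).1 hv with hv | hv
    · rw [o_idx v hv] at *
      obtain ⟨ψ, h1, h2, h3⟩ := hs.cert v hv i hi
      refine ⟨ψ, hc.le h1, h2, fun a ha => ?_⟩
      rcases (tF a).1 ha with ha | ha
      · rw [o_idx a ha, o_idx _ ((equi_F (hs.equi h1) a).2 ha)]
        exact h3 a ha
      · left
        exact hext.2.2.2 ψ h1 a (Qt a ha) (QF a ha)
    · rw [t_idx v (QO v hv)] at *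
      obtain ⟨g, h1, h2, h3, h4⟩ := hc.cert v (QO v hv) i hi
      refine ⟨g, h1, h2, fun a ha => ?_⟩
      rcases (tF a).1 ha with ha | ha
      · left; rw [h3 a (FO a ha)]
      · rw [t_idx a (QO a ha), t_idx _ (hc.map_O g h1 a (QO a ha))]
        exact h4 a (QO a ha)
  case twin =>
    intro a ha b hb hlt φ hφ him hidx
    have mixed : ∀ a ∈ s.F, ∀ b ∈ Q, (∀ c ∈ t.F, t.lt c a ↔ t.lt c b) → False := by
      intro a ha b hb hlt
      obtain ⟨c, h1, h2, h3⟩ := hs.lim a ha b (QF b hb) fun c hcF hca =>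
        (ltFQ c hcF b hb).1 ((hlt c (Ft c hcF)).1 ((ltFF c hcF a ha).2 hca))
      exact h3 ((ltFF c h1 a ha).1 ((hlt c (Ft c h1)).2 ((ltFQ c h1 b hb).2 h2)))
    rcases (tF a).1 ha with ha | ha <;> rcases (tF b).1 hb with hb | hb
    · rw [o_up a ha, o_up b hb] at him
      rw [o_idx a ha, o_idx b hb] at hidx
      refine (eqvFF a ha b hb).2 (hs.twin a ha b hb (fun c hcF => ?_) φ (fun c hcF hca => ?_) him
        hidx)
      · rw [← ltFF c hcF a ha, ← ltFF c hcF b hb]; exact hlt c (Ft c hcF)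
      · exact hφ c (Ft c hcF) ((ltFF c hcF a ha).2 hca)
    · exact (mixed a ha b hb hlt).elim
    · exact (mixed b hb a ha fun c h => (hlt c h).symm).elim
    · rw [t_up a (QO a ha), t_up b (QO b hb)] at him
      rw [t_idx a (QO a ha), t_idx b (QO b hb)] at hidx
      have := hc.twin a (QO a ha) b (QO b hb) (fun c hcF => by
        rw [← ltFQ c hcF a ha, ← ltFQ c hcF b hb]; exact hlt c (Ft c hcF)) φ (fun c hcF hca =>
        hφ c (Ft c hcF) ((ltFQ c hcF a ha).2 hca)) him hidx
      rw [eqvQQ a ha b hb, this]; exact cp_self s b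
  case lim =>
    intro a ha b hb hab
    have hbF : b ∉ s.F := fun h => hb (Ft b h)
    rcases (tF a).1 ha with ha | ha
    · obtain ⟨c, h1, h2, h3⟩ := hs.lim a ha b hbF fun c hcF hca => by
        have := hab c (Ft c hcF) ((ltFF c hcF a ha).2 hca)
        rwa [o_up c hcF] at this
      exact ⟨c, Ft c h1, by rwa [o_up c h1], by rwa [ltFF c h1 a ha]⟩
    · by_cases hsame : s.same b a
      · have hbO := hc.O_cl a (QO a ha) b hbF hsame
        obtain ⟨n, hn⟩ := (val b hbO).X_ne
        obtain ⟨q1, q2, -⟩ := κQ b hbO n hn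
        refine ⟨κ b n, Qt _ q1, ?_, ltQ _ q1 a (Qt a ha)⟩
        rw [t_up _ (QO _ q1)]; exact cp_symm _ _ q2
      · have : ∃ u ∈ s.F, b ∈ s.up u ∧ a ∉ s.up u := by
          by_contra hcon
          push Not at hcon
          refine hsame fun u hu => ⟨hcon u hu, fun hau => ?_⟩
          have := hab u (Ft u hu) ((ltFQ u hu a ha).2 hau)
          rwa [o_up u hu] at this
        obtain ⟨u, hu, h1, h2⟩ := this
        exact ⟨u, Ft u hu, by rwa [o_up u hu], by rwa [ltFQ u hu a ha]⟩
  case nonroot =>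
    intro v hv
    rcases (tF v).1 hv with hv | hv
    · rw [ltFF y hs.yF v hv]; exact hs.nonroot v hv
    · rw [ltFQ y hs.yF v hv, hs.up_y]; exact .inr (.inr (.inr trivial))
  case fix =>
    intro ψ hψ
    rw [t_Ψ] at hψ
    obtain ⟨χ, hχ, h1, -⟩ := hc.proj ψ hψ
    rw [h1 x (FO _ hs.xF), h1 y (FO _ hs.yF), h1 z (FO _ hs.zF)]
    exact hs.fix χ hχ

include hs in
theorem exists_step {x₀ : V} (hx₀ : x₀ ∉ s.F) :
    ∃ t, Good x y z t ∧ Ext s t ∧ ¬ t.F ⊆ s.F := by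
  obtain ⟨O, r, κ, ι, Ψ', hxO, hc⟩ := exists_chart hs hx₀
  obtain ⟨D, hD, hD'⟩ := exists_coherent_blk hs
  have hρ : ∀ a, s.rk a < ⨆ b, Order.succ (s.rk b) := fun a =>
    (Order.lt_succ _).trans_le (Ordinal.le_iSup (fun b => Order.succ (s.rk b)) a)
  refine ⟨s.step O r κ ι Ψ' D _, step_good hs hc hD hD' fun a _ => hρ a, step_ext hc, ?_⟩
  intro h
  have hv := hD _ (hc.O_F _ (hc.r_O _ hxO))
  obtain ⟨n, hn⟩ := hv.X_ne
  have hn0 := hv.X_cp hn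
  have h1 : κ x₀ n ∈ s.cp x₀ := by
    have := (equi_cp (hc.κ_equi x₀ hxO) (r x₀) n).2 hn0
    rwa [hc.κ_r x₀ hxO] at this
  refine cp_off hx₀ h1 (h (.inr ⟨?_, ?_⟩))
  · exact hc.O_cl x₀ hxO _ (cp_off hx₀ h1) (cp_same hs h1)
  · rw [hc.r_κ x₀ hxO n hn0, hD' _ _ hn0]; exact hn

end
end IrrCol

namespace IrrCol
variable {V : Type u} {G : SimpleGraph V}

theorem Ext.refl (s : Pre G) : Ext s s :=
  ⟨subset_rfl, le_rfl, fun _ _ => ⟨rfl, rfl, rfl, rfl, rfl, rfl, rfl⟩,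
    fun _ _ _ h h' => absurd h h'⟩

section
variable {s t : Pre G} (hst : Ext s t)
include hst

theorem Ext.mem {a : V} (ha : a ∈ s.F) : a ∈ t.F := hst.1 ha
theorem Ext.up {a : V} (ha : a ∈ s.F) : t.up a = s.up a := (hst.2.2.1 a ha).1
theorem Ext.par {a : V} (ha : a ∈ s.F) : t.par a = s.par a := (hst.2.2.1 a ha).2.1
theorem Ext.h {a : V} (ha : a ∈ s.F) : t.h a = s.h a := (hst.2.2.1 a ha).2.2.1
theorem Ext.att {a : V} (ha : a ∈ s.F) : t.att a = s.att a := (hst.2.2.1 a ha).2.2.2.1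
theorem Ext.τ {a : V} (ha : a ∈ s.F) : t.τ a = s.τ a := (hst.2.2.1 a ha).2.2.2.2.1
theorem Ext.rk {a : V} (ha : a ∈ s.F) : t.rk a = s.rk a := (hst.2.2.1 a ha).2.2.2.2.2.1
theorem Ext.idx {a : V} (ha : a ∈ s.F) : t.idx a = s.idx a := (hst.2.2.1 a ha).2.2.2.2.2.2

theorem Ext.lt {a b : V} (ha : a ∈ s.F) (hb : b ∈ s.F) : t.lt a b ↔ s.lt a b := by
  simp only [Pre.lt, hst.up ha, hst.up hb]

theorem Ext.eqv {a b : V} (ha : a ∈ s.F) (hb : b ∈ s.F) : t.eqv a b ↔ s.eqv a b := by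
  simp only [Pre.eqv, hst.up ha, hst.up hb]

theorem Ext.Sp {x y z : V} (hs : Good x y z s) {a : V} (ha : a ∈ s.F) (hsp : s.Sp a) :
    t.Sp a := by
  obtain ⟨b, hb, hba, hatt, n, hn⟩ := hsp
  refine ⟨b, hst.mem hb, (hst.eqv hb ha).2 hba, by rw [hst.att hb]; exact hatt, n, ?_⟩
  have : ∀ m : ℕ, t.par^[m] b = s.par^[m] b ∧ s.par^[m] b ∈ s.F := by
    intro m
    induction m with
    | zero => exact ⟨rfl, hb⟩
    | succ m ih =>
      rw [Function.iterate_succ_apply', Function.iterate_succ_apply', ih.1]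
      exact ⟨hst.par ih.2, hs.par_F _ ih.2⟩
  rw [(this n).1, hn]

theorem Ext.trans {x y z : V} {w : Pre G} (ht : Good x y z t) (h' : Ext t w) : Ext s w := by
  refine ⟨hst.1.trans h'.1, hst.2.1.trans h'.2.1, fun v hv => ?_, fun ψ hψ v hv hvs => ?_⟩
  · have hv' := hst.mem hv
    rw [h'.up hv', h'.par hv', h'.h hv', h'.att hv', h'.τ hv', h'.rk hv', h'.idx hv']
    exact hst.2.2.1 v hv
  · by_cases hvt : v ∈ t.F
    · rw [h'.idx hvt, h'.idx ((equi_F (ht.equi (hst.2.1 hψ)) v).2 hvt)]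
      exact hst.2.2.2 ψ hψ v hvt hvs
    · exact h'.2.2.2 ψ (hst.2.1 hψ) v hv hvt

end

open Classical in
theorem exists_initial {x y z : V} (hconn : Conn G Set.univ) (hxy : G.Adj x y) (hyz : G.Adj y z) :
    ∃ s, Good x y z (s : Pre G) := by
  have hx : x ≠ y := hxy.ne
  have hz : z ≠ y := hyz.ne.symm
  refine ⟨⟨{x, y, z}, fun _ => Set.univ, fun _ => y, fun v => if v = y then 0 else 1, fun _ => ∅,
    fun _ => 0, fun _ => 0, fun _ => 0, ⊥⟩, ?_⟩
  constructor
  case equi => exact bot_le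
  case xF => simp
  case yF => simp
  case zF => simp
  case h_x => simp [hx]
  case h_z => simp [hz]
  case par_adj =>
    rintro v (rfl | rfl | rfl) h
    · exact hxy
    · simp at h
    · exact hyz.symm
  case vis =>
    intro a ha b hb hba
    by_cases h : a = y
    · right; exact ⟨x, by simp, by simp [hx], h.symm⟩
    · left; simp [h]
  case lim =>
    intro a ha b hb _
    exact ⟨a, ha, trivial, fun h => h.2 trivial⟩
  case semi =>
    intro ψ hψ v hv _
    rw [Subgroup.mem_bot] at hψ
    subst hψ
    simp
  case fix =>
    intro ψ hψ
    rw [Subgroup.mem_bot] at hψ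
    subst hψ
    simp
  case nonroot =>
    rintro v (rfl | rfl | rfl) <;> simp
  case base =>
    intro a _ b _ _ h1 h2
    by_contra hab
    by_cases h : a = y
    · by_cases h' : b = y
      · exact hab (h.trans h'.symm)
      · simp [h'] at h2
    · simp [h] at h1
  case twin => intros; exact ⟨trivial, trivial⟩
  all_goals simp_all [Pre.lt, Pre.eqv]

section
variable {x y z : V} {c : Set (Pre G)} (hc : ∀ s ∈ c, ∀ t ∈ c, Ext s t ∨ Ext t s)
  (hg : ∀ s ∈ c, Good x y z s) (hne : c.Nonempty)
include hc hg hne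

open Classical in
theorem exists_union : ∃ U : Pre G, (∀ s ∈ c, Ext s U) ∧ (∀ v ∈ U.F, ∃ s ∈ c, v ∈ s.F) ∧
    ∀ ψ ∈ U.Ψ, ∃ s ∈ c, ψ ∈ s.Ψ := by
  obtain ⟨s₀, hs₀⟩ := hne
  have hS : ∀ v, ∃ s, s ∈ c ∧ ((∃ s' ∈ c, v ∈ s'.F) → v ∈ s.F) := by
    intro v
    by_cases h : ∃ s' ∈ c, v ∈ s'.F
    · obtain ⟨s', h1, h2⟩ := h; exact ⟨s', h1, fun _ => h2⟩
    · exact ⟨s₀, hs₀, fun h' => absurd h' h⟩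
  choose S hSc hSF using hS
  let Ψ : Subgroup (G ≃g G) :=
    { carrier := {g | ∃ s ∈ c, g ∈ s.Ψ}
      one_mem' := ⟨s₀, hs₀, one_mem _⟩
      mul_mem' := by
        rintro a b ⟨s, hs, ha⟩ ⟨t, ht, hb⟩
        rcases hc s hs t ht with h | h
        · exact ⟨t, ht, mul_mem (h.2.1 ha) hb⟩
        · exact ⟨s, hs, mul_mem ha (h.2.1 hb)⟩
      inv_mem' := by
        rintro a ⟨s, hs, ha⟩; exact ⟨s, hs, inv_mem ha⟩ }
  refine ⟨⟨{v | ∃ s ∈ c, v ∈ s.F}, fun v => (S v).up v, fun v => (S v).par v, fun v => (S v).h v,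
    fun v => (S v).att v, fun v => (S v).τ v, fun v => (S v).rk v, fun v => (S v).idx v, Ψ⟩,
    fun s hs => ?_, fun v hv => hv, fun ψ hψ => hψ⟩
  have agree : ∀ s ∈ c, ∀ v ∈ s.F, (S v).up v = s.up v ∧ (S v).par v = s.par v ∧
      (S v).h v = s.h v ∧ (S v).att v = s.att v ∧ (S v).τ v = s.τ v ∧ (S v).rk v = s.rk v ∧
      (S v).idx v = s.idx v := by
    intro s hs v hv
    rcases hc s hs (S v) (hSc v) with h | h
    · exact h.2.2.1 v hv
    · obtain ⟨h1, h2, h3, h4, h5, h6, h7⟩ := h.2.2.1 v (hSF v ⟨s, hs, hv⟩)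
      exact ⟨h1.symm, h2.symm, h3.symm, h4.symm, h5.symm, h6.symm, h7.symm⟩
  refine ⟨fun v hv => ⟨s, hs, hv⟩, fun g hg => ⟨s, hs, hg⟩, agree s hs, fun ψ hψ v hv hvs => ?_⟩
  have hvS := hSF v hv
  have hE : Ext s (S v) := (hc s hs (S v) (hSc v)).resolve_right fun h => hvs (h.mem hvS)
  have h1 := hE.2.2.2 ψ hψ v hvS hvs
  have h2 := (equi_F ((hg _ (hSc v)).equi (hE.2.1 hψ)) v).2 hvS
  exact ((agree _ (hSc v) _ h2).2.2.2.2.2.2).trans h1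

theorem union_good {U : Pre G} (hU : ∀ s ∈ c, Ext s U) (hUF : ∀ v ∈ U.F, ∃ s ∈ c, v ∈ s.F)
    (hUΨ : ∀ ψ ∈ U.Ψ, ∃ s ∈ c, ψ ∈ s.Ψ) : Good x y z U := by
  have two : ∀ a ∈ U.F, ∀ b ∈ U.F, ∃ s ∈ c, a ∈ s.F ∧ b ∈ s.F := by
    intro a ha b hb
    obtain ⟨s, hs, has⟩ := hUF a ha
    obtain ⟨t, ht, hbt⟩ := hUF b hb
    rcases hc s hs t ht with h | h
    · exact ⟨t, ht, h.mem has, hbt⟩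
    · exact ⟨s, hs, has, h.mem hbt⟩
  have mix : ∀ ψ ∈ U.Ψ, ∀ a ∈ U.F, ∃ s ∈ c, a ∈ s.F ∧ ψ ∈ s.Ψ := by
    intro ψ hψ a ha
    obtain ⟨s, hs, has⟩ := hUF a ha
    obtain ⟨t, ht, hbt⟩ := hUΨ ψ hψ
    rcases hc s hs t ht with h | h
    · exact ⟨t, ht, h.mem has, hbt⟩
    · exact ⟨s, hs, has, h.2.1 hbt⟩
  obtain ⟨s₀, hs₀⟩ := hne
  have g₀ := hg s₀ hs₀
  have e₀ := hU s₀ hs₀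
  refine
    { self := ?self, trans := ?trans, comp := ?comp, rk := ?rk, nbr := ?nbr, conn := ?conn,
      par_F := ?par_F, par_eqv := ?par_eqv, par_zero := ?par_zero, par_adj := ?par_adj,
      h_par := ?h_par, base := ?base, att_F := ?att_F, att_lt := ?att_lt, att_adj := ?att_adj,
      att_τ := ?att_τ, att_uniq := ?att_uniq, cofinal := ?cofinal, sp := ?sp, τ_eqv := ?τ_eqv,
      idx_eqv := ?idx_eqv, vis := ?vis, semi := ?semi, equi := ?equi, cert := ?cert,
      twin := ?twin, lim := ?lim, xF := e₀.mem g₀.xF, yF := e₀.mem g₀.yF, zF := e₀.mem g₀.zF,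
      up_y := by rw [e₀.up g₀.yF, g₀.up_y], nonroot := ?nonroot,
      h_y := by rw [e₀.h g₀.yF, g₀.h_y], h_x := by rw [e₀.h g₀.xF, g₀.h_x],
      h_z := by rw [e₀.h g₀.zF, g₀.h_z], par_x := by rw [e₀.par g₀.xF, g₀.par_x],
      par_z := by rw [e₀.par g₀.zF, g₀.par_z], fix := ?fix }
  case fix =>
    intro ψ hψ
    obtain ⟨s, hs, h⟩ := hUΨ ψ hψ
    exact (hg s hs).fix ψ h
  case self =>
    intro v hv
    obtain ⟨s, hs, h⟩ := hUF v hv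
    rw [(hU s hs).up h]; exact (hg s hs).self v h
  case conn =>
    intro v hv
    obtain ⟨s, hs, h⟩ := hUF v hv
    rw [(hU s hs).up h]; exact (hg s hs).conn v h
  case par_F =>
    intro v hv
    obtain ⟨s, hs, h⟩ := hUF v hv
    rw [(hU s hs).par h]; exact (hU s hs).mem ((hg s hs).par_F v h)
  case par_eqv =>
    intro v hv
    obtain ⟨s, hs, h⟩ := hUF v hv
    rw [(hU s hs).par h, (hU s hs).eqv h ((hg s hs).par_F v h)]
    exact (hg s hs).par_eqv v h
  case par_zero =>
    intro v hv
    obtain ⟨s, hs, h⟩ := hUF v hv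
    rw [(hU s hs).par h, (hU s hs).h h]; exact (hg s hs).par_zero v h
  case par_adj =>
    intro v hv
    obtain ⟨s, hs, h⟩ := hUF v hv
    rw [(hU s hs).par h, (hU s hs).h h]; exact (hg s hs).par_adj v h
  case h_par =>
    intro v hv
    obtain ⟨s, hs, h⟩ := hUF v hv
    rw [(hU s hs).par h, (hU s hs).h h, (hU s hs).h ((hg s hs).par_F v h)]
    exact (hg s hs).h_par v h
  case trans =>
    intro a ha b hb
    obtain ⟨s, hs, h1, h2⟩ := two a ha b hb
    rw [(hU s hs).up h1, (hU s hs).up h2]; exact (hg s hs).trans a h1 b h2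
  case comp =>
    intro a ha b hb
    obtain ⟨s, hs, h1, h2⟩ := two a ha b hb
    rw [(hU s hs).up h1, (hU s hs).up h2]; exact (hg s hs).comp a h1 b h2
  case rk =>
    intro a ha b hb
    obtain ⟨s, hs, h1, h2⟩ := two a ha b hb
    rw [(hU s hs).lt h1 h2, (hU s hs).rk h1, (hU s hs).rk h2]; exact (hg s hs).rk a h1 b h2
  case nbr =>
    intro a ha b hb d hbd
    obtain ⟨s, hs, h⟩ := hUF a ha
    rw [(hU s hs).up h] at *
    rcases (hg s hs).nbr a h b hb d hbd with h' | ⟨h1, h2⟩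
    · exact .inl h'
    · exact .inr ⟨(hU s hs).mem h1, by rwa [(hU s hs).up h1]⟩
  case base =>
    intro a ha b hb
    obtain ⟨s, hs, h1, h2⟩ := two a ha b hb
    rw [(hU s hs).eqv h1 h2, (hU s hs).h h1, (hU s hs).h h2]
    exact (hg s hs).base a h1 b h2
  case att_F =>
    intro v hv a hav
    obtain ⟨s, hs, h⟩ := hUF v hv
    rw [(hU s hs).att h] at hav
    exact (hU s hs).mem ((hg s hs).att_F v h a hav)
  case att_lt =>
    intro v hv a hav
    obtain ⟨s, hs, h⟩ := hUF v hv
    rw [(hU s hs).att h] at hav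
    rw [(hU s hs).lt ((hg s hs).att_F v h a hav) h]
    exact (hg s hs).att_lt v h a hav
  case att_adj =>
    intro v hv a hav
    obtain ⟨s, hs, h⟩ := hUF v hv
    rw [(hU s hs).att h] at hav
    exact (hg s hs).att_adj v h a hav
  case att_τ =>
    intro v hv a hav
    obtain ⟨s, hs, h⟩ := hUF v hv
    rw [(hU s hs).att h] at hav
    rw [(hU s hs).τ ((hg s hs).att_F v h a hav), (hU s hs).τ h]
    exact (hg s hs).att_τ v h a hav
  case att_uniq =>
    intro a ha b hb
    obtain ⟨s, hs, h1, h2⟩ := two a ha b hb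
    rw [(hU s hs).eqv h1 h2, (hU s hs).att h1, (hU s hs).att h2]
    exact (hg s hs).att_uniq a h1 b h2
  case cofinal =>
    intro a ha b hb hab
    obtain ⟨s, hs, h1, h2⟩ := two a ha b hb
    rw [(hU s hs).lt h1 h2] at hab
    obtain ⟨a', p1, p2, b', p3, p4, p5⟩ := (hg s hs).cofinal a h1 b h2 hab
    exact ⟨a', (hU s hs).mem p1, by rwa [(hU s hs).up h1], b', (hU s hs).mem p3,
      ((hU s hs).eqv h2 p3).2 p4, by rwa [(hU s hs).att p3]⟩
  case sp =>
    intro a ha b hb hab hya q1 q2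
    obtain ⟨s, hs, h1, h2⟩ := two a ha b hb
    rw [(hU s hs).eqv h1 h2] at hab
    rw [(hU s hs).lt (hg s hs).yF h1] at hya
    exact (hg s hs).sp a h1 b h2 hab hya (fun h => q1 ((hU s hs).Sp (hg s hs) h1 h))
      (fun h => q2 ((hU s hs).Sp (hg s hs) h2 h))
  case τ_eqv =>
    intro a ha b hb
    obtain ⟨s, hs, h1, h2⟩ := two a ha b hb
    rw [(hU s hs).eqv h1 h2, (hU s hs).τ h1, (hU s hs).τ h2]
    exact (hg s hs).τ_eqv a h1 b h2
  case idx_eqv =>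
    intro a ha b hb
    obtain ⟨s, hs, h1, h2⟩ := two a ha b hb
    rw [(hU s hs).eqv h1 h2, (hU s hs).idx h1, (hU s hs).idx h2]
    exact (hg s hs).idx_eqv a h1 b h2
  case vis =>
    intro a ha b hb hba
    obtain ⟨s, hs, h⟩ := hUF a ha
    rw [(hU s hs).up h] at hb
    rcases (hg s hs).vis a h b hb hba with h' | ⟨d, h1, h2, h3⟩
    · left; rwa [(hU s hs).h h]
    · right
      exact ⟨d, (hU s hs).mem h1, by rwa [(hU s hs).h h1], by rwa [(hU s hs).par h1]⟩
  case semi =>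
    intro ψ hψ v hv hsame
    have key : ∀ s ∈ c, ψ ∈ s.Ψ → ψ v = v ∧ ∀ a ∈ s.F, v ∈ s.up a → ψ a = a := by
      intro s hs h
      refine (hg s hs).semi ψ h v (fun h' => hv ((hU s hs).mem h')) fun a ha => ?_
      rw [← (hU s hs).up ha]; exact hsame a ((hU s hs).mem ha)
    obtain ⟨s, hs, h⟩ := hUΨ ψ hψ
    refine ⟨(key s hs h).1, fun a ha hva => ?_⟩
    obtain ⟨t, ht, h1, h2⟩ := mix ψ hψ a ha
    rw [(hU t ht).up h1] at hva
    exact (key t ht h2).2 a h1 hva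
  case equi =>
    intro ψ hψ v
    have key : ψ v ∈ U.F ↔ v ∈ U.F := by
      constructor
      · intro h
        obtain ⟨s, hs, h1, h2⟩ := mix ψ hψ _ h
        exact (hU s hs).mem ((equi_F ((hg s hs).equi h2) v).1 h1)
      · intro h
        obtain ⟨s, hs, h1, h2⟩ := mix ψ hψ _ h
        exact (hU s hs).mem ((equi_F ((hg s hs).equi h2) v).2 h1)
    refine ⟨key, fun hv => ?_⟩
    obtain ⟨s, hs, h1, h2⟩ := mix ψ hψ v hv
    have h3 := (equi_F ((hg s hs).equi h2) v).2 h1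
    have e := hU s hs
    rw [e.up h1, e.up h3, e.par h1, e.par h3, e.h h1, e.h h3, e.τ h1, e.τ h3, e.att h1, e.att h3]
    exact ((hg s hs).equi h2 v).2 h1
  case cert =>
    intro v hv i hi
    obtain ⟨s, hs, h⟩ := hUF v hv
    have e := hU s hs
    rw [e.idx h] at *
    obtain ⟨ψ, h1, h2, h3⟩ := (hg s hs).cert v h i hi
    refine ⟨ψ, e.2.1 h1, h2, fun a ha => ?_⟩
    by_cases has : a ∈ s.F
    · rw [e.idx has, e.idx ((equi_F ((hg s hs).equi h1) a).2 has)]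
      exact h3 a has
    · exact .inl (e.2.2.2 ψ h1 a ha has)
  case twin =>
    intro a ha b hb hlt φ hφ him hidx
    obtain ⟨s, hs, h1, h2⟩ := two a ha b hb
    have e := hU s hs
    rw [e.eqv h1 h2]
    rw [e.up h1, e.up h2] at him
    rw [e.idx h1, e.idx h2] at hidx
    refine (hg s hs).twin a h1 b h2 (fun d hd => ?_) φ (fun d hd hda => ?_) him hidx
    · rw [← e.lt hd h1, ← e.lt hd h2]; exact hlt d (e.mem hd)
    · exact hφ d (e.mem hd) ((e.lt hd h1).2 hda)
  case lim =>
    intro a ha b hb hab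
    obtain ⟨s, hs, h⟩ := hUF a ha
    have e := hU s hs
    obtain ⟨d, h1, h2, h3⟩ := (hg s hs).lim a h b (fun h' => hb (e.mem h')) fun d hd hda => by
      have := hab d (e.mem hd) ((e.lt hd h).2 hda)
      rwa [e.up hd] at this
    exact ⟨d, e.mem h1, by rwa [e.up h1], by rwa [e.lt h1 h]⟩
  case nonroot =>
    intro v hv
    obtain ⟨s, hs, h⟩ := hUF v hv
    rw [(hU s hs).lt (hg s hs).yF h]
    exact (hg s hs).nonroot v h

end

theorem exists_good {x y z : V} (hconn : Conn G Set.univ) (hxy : G.Adj x y) (hyz : G.Adj y z) :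
    ∃ s : Pre G, Good x y z s ∧ ∀ v, v ∈ s.F := by
  obtain ⟨⟨m, hm⟩, hmax⟩ := exists_maximal_of_chains_bounded
    (α := {s : Pre G // Good x y z s}) (r := fun s t => Ext s.1 t.1) (fun c hc => by
      by_cases hne : c.Nonempty
      · have hc' : ∀ s ∈ Subtype.val '' c, ∀ t ∈ Subtype.val '' c, Ext s t ∨ Ext t s := by
          rintro _ ⟨s, hs, rfl⟩ _ ⟨t, ht, rfl⟩
          by_cases hst : s = t
          · subst hst; exact .inl (Ext.refl _)
          · exact hc hs ht hst
        have hg : ∀ s ∈ Subtype.val '' c, Good x y z s := by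
          rintro _ ⟨s, hs, rfl⟩; exact s.2
        obtain ⟨U, h1, h2, h3⟩ := exists_union hc' hg (hne.image _)
        exact ⟨⟨U, union_good hc' hg (hne.image _) h1 h2 h3⟩, fun s hs => h1 _ ⟨s, hs, rfl⟩⟩
      · obtain ⟨s, hs⟩ := exists_initial (x := x) (y := y) (z := z) hconn hxy hyz
        exact ⟨⟨s, hs⟩, fun a ha => absurd ⟨a, ha⟩ hne⟩)
    (fun {a b c} h h' => Ext.trans h b.2 h')
  refine ⟨m, hm, fun v => ?_⟩
  by_contra hv
  obtain ⟨t, ht, hext, hnot⟩ := exists_step hm hv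
  exact hnot (hmax ⟨t, ht⟩ hext).1

/-- Connected graphs with a path of length two have a distinguishing colouring with finitely many
colours besides ordinal colours that cannot be merged with each other. -/
theorem exists_almost_irreducible {x y z : V} (hconn : Conn G Set.univ) (hxy : G.Adj x y)
    (hyz : G.Adj y z) (hxz : x ≠ z) :
    ∃ c : V → V → BaseCol ⊕ Ordinal.{u}, (∀ a b, c a b = c b a) ∧
      (∀ φ : G ≃g G, (∀ a b, G.Adj a b → c (φ a) (φ b) = c a b) → ∀ v, φ v = v) ∧
      ∀ i j a b, i < j → c a b = .inr j → ∃ ψ : G ≃g G, (∃ v, ψ v ≠ v) ∧ ∀ u v,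
        c (ψ u) (ψ v) = c u v ∨ (c u v = .inr i ∧ c (ψ u) (ψ v) = .inr j) ∨
          (c u v = .inr j ∧ c (ψ u) (ψ v) = .inr i) := by
  obtain ⟨s, hs, hF⟩ := exists_good hconn hxy hyz
  exact ⟨s.col x z, fun a b => col_symm hs hF a b, fun φ hφ v => dist hs hF hxz hφ v,
    fun i j a b hij hab => unmerge hs hF hij hab⟩

end IrrCol

namespace IrrCol
variable {V : Type u} {G : SimpleGraph V}

/-- Only the identity preserves `c` on the edges of `G`. -/
def Dist {C : Type*} (G : SimpleGraph V) (c : V → V → C) : Prop :=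
  ∀ φ : G ≃g G, (∀ a b, G.Adj a b → c (φ a) (φ b) = c a b) → ∀ v, φ v = v

/-- The colour `i` occurs on an edge of `G`. -/
def Used {C : Type*} (G : SimpleGraph V) (c : V → V → C) (i : C) : Prop :=
  ∃ a b, G.Adj a b ∧ c a b = i

/-- Some nontrivial automorphism of `G` preserves `c` up to exchanging the colours `i` and `j`. -/
def Swaps {C : Type*} (G : SimpleGraph V) (c : V → V → C) (i j : C) : Prop :=
  ∃ ψ : G ≃g G, (∃ v, ψ v ≠ v) ∧ ∀ u v, G.Adj u v →
    c (ψ u) (ψ v) = c u v ∨ (c u v = i ∧ c (ψ u) (ψ v) = j) ∨ (c u v = j ∧ c (ψ u) (ψ v) = i)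

theorem Swaps.symm {C : Type*} {c : V → V → C} {i j : C} (h : Swaps G c i j) : Swaps G c j i := by
  obtain ⟨ψ, h1, h2⟩ := h
  exact ⟨ψ, h1, fun u v huv => (h2 u v huv).imp_right Or.symm⟩

/-- Irreducible distinguishing colourings. -/
structure Irr {C : Type*} (G : SimpleGraph V) (c : V → V → C) : Prop where
  symm : ∀ a b, c a b = c b a
  dist : Dist G c
  swaps : ∀ i j, i ≠ j → Used G c i → Used G c j → Swaps G c i j

open Classical in
theorem exists_irr_sum {S T : Type*} [Finite S] (c : V → V → S ⊕ T) (hsymm : ∀ a b, c a b = c b a)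
    (hdist : Dist G c)
    (hT : ∀ i j : T, i ≠ j → Used G c (.inr i) → Used G c (.inr j) → Swaps G c (.inr i) (.inr j)) :
    ∃ c' : V → V → S ⊕ T, Irr G c' := by
  generalize hn : Set.ncard {s : S | Used G c (.inl s)} = n
  induction n using Nat.strong_induction_on generalizing c with
  | _ n ih =>
  by_cases hirr : ∀ i j, i ≠ j → Used G c i → Used G c j → Swaps G c i j
  · exact ⟨c, hsymm, hdist, hirr⟩
  obtain ⟨a, s, has, ha, hs, hnot⟩ : ∃ (a : S ⊕ T) (s : S), a ≠ .inl s ∧ Used G c a ∧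
      Used G c (.inl s) ∧ ¬ Swaps G c a (.inl s) := by
    push Not at hirr
    obtain ⟨i, j, hij, hi, hj, hnot⟩ := hirr
    rcases j with s | j
    · exact ⟨i, s, hij, hi, hj, hnot⟩
    rcases i with s | i
    · exact ⟨.inr j, s, hij.symm, hj, hi, fun h => hnot h.symm⟩
    · exact absurd (hT i j (fun h => hij (by rw [h])) hi hj) hnot
  set c' : V → V → S ⊕ T := fun u v => if c u v = .inl s then a else c u v with hc'
  have used : ∀ k, Used G c' k → Used G c k ∧ k ≠ .inl s := by
    rintro k ⟨u, v, huv, rfl⟩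
    by_cases h : c u v = .inl s
    · simp only [hc', if_pos h]; exact ⟨ha, has⟩
    · simp only [hc', if_neg h]; exact ⟨⟨u, v, huv, rfl⟩, h⟩
  refine ih _ ?_ c' (fun u v => by simp only [hc', hsymm u v]) (fun φ hφ => ?_)
    (fun i j hij hi hj => ?_) rfl
  · rw [← hn]
    refine Set.ncard_lt_ncard ⟨fun t ht => (used _ ht).1, fun h => (used _ (h hs)).2 rfl⟩
      (Set.toFinite _)
  · by_contra hne
    push Not at hne
    refine hnot ⟨φ, hne, fun u v huv => ?_⟩
    have := hφ u v huv
    simp only [hc'] at this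
    split_ifs at this with h1 h2 h2
    · left; rw [h1, h2]
    · right; left; exact ⟨this.symm, h1⟩
    · right; right; exact ⟨h2, this⟩
    · left; exact this
  · obtain ⟨ψ, h1, h2⟩ := hT i j hij (used _ hi).1 (used _ hj).1
    refine ⟨ψ, h1, fun u v huv => ?_⟩
    rcases h2 u v huv with h | ⟨h, h'⟩ | ⟨h, h'⟩
    · left; simp only [hc', h]
    · right; left; simp [hc', h, h']
    · right; right; simp [hc', h, h']

/-- The colours of an irreducible colouring can be renamed to pairs of vertices. -/
theorem Irr.exists_prod {C : Type*} {c : V → V → C} (hc : Irr G c) :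
    ∃ c' : V → V → V × V, Irr G c' := by
  have hex : ∀ a b, ∃ p : V × V, c p.1 p.2 = c a b := fun a b => ⟨(a, b), rfl⟩
  let g : Set.range (fun p : V × V => c p.1 p.2) → V × V := fun i => i.2.choose
  have hg : ∀ i, c (g i).1 (g i).2 = i := fun i => i.2.choose_spec
  have key : ∀ a b a' b', g ⟨c a b, (a, b), rfl⟩ = g ⟨c a' b', (a', b'), rfl⟩ ↔
      c a b = c a' b' := by
    intro a b a' b'
    constructor
    · intro h
      have h1 := hg ⟨c a b, (a, b), rfl⟩
      rw [h, hg] at h1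
      exact h1.symm
    · intro h
      congr 1
      exact Subtype.ext h
  refine ⟨fun a b => g ⟨c a b, (a, b), rfl⟩, fun a b => (key _ _ _ _).2 (hc.symm a b),
    fun φ hφ => hc.dist φ fun a b hab => (key _ _ _ _).1 (hφ a b hab), ?_⟩
  rintro i j hij ⟨a, b, hab, rfl⟩ ⟨a', b', hab', rfl⟩
  obtain ⟨ψ, h1, h2⟩ := hc.swaps (c a b) (c a' b') (fun h => hij ((key _ _ _ _).2 h))
    ⟨a, b, hab, rfl⟩ ⟨a', b', hab', rfl⟩
  refine ⟨ψ, h1, fun u v huv => ?_⟩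
  simp only [key]
  exact h2 u v huv

theorem exists_irr_of_path {x y z : V} (hconn : Conn G Set.univ) (hxy : G.Adj x y)
    (hyz : G.Adj y z) (hxz : x ≠ z) : ∃ c : V → V → V × V, Irr G c := by
  obtain ⟨c, h1, h2, h3⟩ := exists_almost_irreducible hconn hxy hyz hxz
  have h4 : ∀ i j, i < j → Used G c (.inr j) → Swaps G c (.inr i) (.inr j) := by
    rintro i j hij ⟨a, b, _, hab⟩
    obtain ⟨ψ, h, h'⟩ := h3 i j a b hij hab
    exact ⟨ψ, h, fun u v _ => h' u v⟩
  obtain ⟨c', hc'⟩ := exists_irr_sum c h1 h2 fun i j hij hi hj => by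
    rcases lt_or_gt_of_ne hij with h | h
    · exact h4 i j h hj
    · exact (h4 j i h hi).symm
  exact hc'.exists_prod

/-- Colours of different fibres of an invariant of the colours may be identified. -/
theorem exists_irr_of_fibres {Y : Type u} {Z : Type*} (e : V → V → Y) (f : Y → Z)
    (hsymm : ∀ a b, G.Adj a b → e a b = e b a) (hdist : Dist G e)
    (hf : ∀ (φ : G ≃g G) (a b : V), G.Adj a b → f (e (φ a) (φ b)) = f (e a b))
    (hswap : ∀ i j, f i = f j → i ≠ j → Used G e i → Used G e j → Swaps G e i j) :
    ∃ c : V → V → V × V, Irr G c := by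
  classical
  obtain ⟨ι, h1, h2⟩ := exists_fibre_index (fun y : {y : Y // Used G e y} => f y)
  let c : V → V → Ordinal.{u} := fun a b =>
    if h : G.Adj a b then ι ⟨e a b, a, b, h, rfl⟩ else 0
  have hc : ∀ a b (h : G.Adj a b), c a b = ι ⟨e a b, a, b, h, rfl⟩ := fun a b h => dif_pos h
  have hlt : ∀ i j, i < j → Used G c j → Swaps G c i j := by
    rintro i j hij ⟨a, b, hab, rfl⟩
    rw [hc a b hab] at hij
    obtain ⟨y', hy', hi⟩ := h2 _ _ hij
    obtain ⟨ψ, h3, h4⟩ := hswap y' (e a b) hy'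
      (fun h => hij.ne (by rw [← hi]; congr 1; exact Subtype.ext h)) y'.2 ⟨a, b, hab, rfl⟩
    refine ⟨ψ, h3, fun u v huv => ?_⟩
    have huv' := ψ.map_rel_iff.2 huv
    rw [hc u v huv, hc _ _ huv', hc a b hab, ← hi]
    refine (h4 u v huv).imp (fun h => ?_) (Or.imp (fun h => ?_) (fun h => ?_))
    · congr 1; exact Subtype.ext h
    · exact ⟨congrArg ι (Subtype.ext h.1), congrArg ι (Subtype.ext h.2)⟩
    · exact ⟨congrArg ι (Subtype.ext h.1), congrArg ι (Subtype.ext h.2)⟩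
  have : Irr G c := by
    refine ⟨fun a b => ?_, fun φ hφ => hdist φ fun a b hab => ?_, fun i j hij hi hj => ?_⟩
    · by_cases h : G.Adj a b
      · rw [hc a b h, hc b a h.symm]
        congr 1; exact Subtype.ext (hsymm a b h)
      · simp only [c, dif_neg h, dif_neg (fun h' : G.Adj b a => h h'.symm)]
    · have h3 := hφ a b hab
      rw [hc a b hab, hc _ _ (φ.map_rel_iff.2 hab)] at h3
      exact congrArg Subtype.val (h1 _ _ (hf φ a b hab) h3)
    · rcases lt_or_gt_of_ne hij with h | h
      · exact hlt i j h hj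
      · exact (hlt j i h hi).symm
  exact this.exists_prod

end IrrCol

namespace IrrCol
variable {V : Type u} {G : SimpleGraph V}

theorem Irr.map {C D : Type*} {c : V → V → C} (hc : Irr G c) {f : C → D}
    (hf : Function.Injective f) : Irr G (fun a b => f (c a b)) := by
  refine ⟨fun a b => by rw [hc.symm], fun φ hφ => hc.dist φ fun a b hab => hf (hφ a b hab), ?_⟩
  rintro i j hij ⟨a, b, hab, rfl⟩ ⟨a', b', hab', rfl⟩
  obtain ⟨ψ, h1, h2⟩ := hc.swaps (c a b) (c a' b') (fun h => hij (congrArg f h))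
    ⟨a, b, hab, rfl⟩ ⟨a', b', hab', rfl⟩
  refine ⟨ψ, h1, fun u v huv => ?_⟩
  simp only [hf.eq_iff]
  exact h2 u v huv

theorem Irr.comap {W : Type*} {H : SimpleGraph W} {C : Type*} {c : V → V → C} (hc : Irr G c)
    (θ : H ≃g G) : Irr H (fun a b => c (θ a) (θ b)) := by
  refine ⟨fun a b => hc.symm _ _, fun φ hφ v => ?_, ?_⟩
  · have := hc.dist (θ.symm.trans (φ.trans θ)) (fun a b hab => by
      have := hφ (θ.symm a) (θ.symm b) (θ.symm.map_rel_iff.2 hab)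
      simpa using this) (θ v)
    simpa using this
  · rintro i j hij ⟨a, b, hab, hi⟩ ⟨a', b', hab', hj⟩
    obtain ⟨ψ, ⟨v, hv⟩, h2⟩ := hc.swaps i j hij ⟨_, _, θ.map_rel_iff.2 hab, hi⟩
      ⟨_, _, θ.map_rel_iff.2 hab', hj⟩
    refine ⟨θ.trans (ψ.trans θ.symm), ⟨θ.symm v, fun h => hv ?_⟩, fun u w huw => ?_⟩
    · have := congrArg θ h
      simpa using this
    · have := h2 (θ u) (θ w) (θ.map_rel_iff.2 huw)
      simpa using this

/-- Isomorphisms between the components of a graph can be glued. -/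
theorem exists_glue (π : G.ConnectedComponent ≃ G.ConnectedComponent)
    (T : ∀ K : G.ConnectedComponent, G.induce K.supp ≃g G.induce (π K).supp) :
    ∃ ψ : G ≃g G, ∀ (K : G.ConnectedComponent) (a : K.supp), ψ a = T K a := by
  let f : V → V := fun v => T (G.connectedComponentMk v) ⟨v, rfl⟩
  have hf : ∀ (K : G.ConnectedComponent) (a : K.supp), f a = T K a := by
    rintro K ⟨a, rfl⟩; rfl
  have hmk : ∀ v, G.connectedComponentMk (f v) = π (G.connectedComponentMk v) := fun v =>
    (T (G.connectedComponentMk v) ⟨v, rfl⟩).2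
  have hinj : Function.Injective f := by
    intro u v huv
    have h : G.connectedComponentMk u = G.connectedComponentMk v :=
      π.injective (by rw [← hmk, ← hmk, huv])
    have := hf (G.connectedComponentMk v) ⟨u, h⟩
    have h2 := hf (G.connectedComponentMk v) ⟨v, rfl⟩
    simp only at this h2
    rw [huv, h2] at this
    exact (congrArg Subtype.val ((T _).injective (Subtype.ext this))).symm
  have hsurj : Function.Surjective f := by
    intro w
    obtain ⟨K, hK⟩ := π.surjective (G.connectedComponentMk w)
    refine ⟨(T K).symm ⟨w, hK.symm⟩, ?_⟩
    rw [hf]; simp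
  refine ⟨⟨Equiv.ofBijective f ⟨hinj, hsurj⟩, ?_⟩, hf⟩
  intro u v
  change G.Adj (f u) (f v) ↔ G.Adj u v
  by_cases h : G.connectedComponentMk u = G.connectedComponentMk v
  · have h1 := hf (G.connectedComponentMk v) ⟨u, h⟩
    have h2 := hf (G.connectedComponentMk v) ⟨v, rfl⟩
    simp only at h1 h2
    rw [h1, h2]
    exact (T (G.connectedComponentMk v)).map_rel_iff (a := ⟨u, h⟩) (b := ⟨v, rfl⟩)
  · constructor
    · intro h'
      have := SimpleGraph.ConnectedComponent.connectedComponentMk_eq_of_adj h'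
      rw [hmk, hmk] at this
      exact absurd (π.injective this) h
    · intro h'
      exact absurd (SimpleGraph.ConnectedComponent.connectedComponentMk_eq_of_adj h') h

theorem exists_restrict (φ : G ≃g G) (v : V) :
    ∃ g : G.induce (G.connectedComponentMk v).supp ≃g G.induce (G.connectedComponentMk (φ v)).supp,
      ∀ a, (g a : V) = φ a := by
  have h : ∀ a, a ∈ (G.connectedComponentMk v).supp ↔ φ a ∈ (G.connectedComponentMk (φ v)).supp := by
    intro a
    simp only [SimpleGraph.ConnectedComponent.mem_supp_iff, SimpleGraph.ConnectedComponent.eq]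
    exact φ.reachable_iff.symm
  exact ⟨⟨φ.toEquiv.subtypeEquiv h, fun {a b} => φ.map_rel_iff⟩, fun a => rfl⟩

theorem conn_component (K : G.ConnectedComponent) : Conn (G.induce K.supp) Set.univ := by
  intro T _ ⟨t, ht⟩ hcl v _
  obtain ⟨p⟩ := K.connected_toSimpleGraph.preconnected t v
  induction p with
  | nil => exact ht
  | cons h p ih => exact ih (hcl _ ht _ trivial h) trivial

theorem exists_irr_component (hedge : ∀ u v : V, ¬ IsolatedEdge G u v)
    (K : G.ConnectedComponent) : ∃ c : K.supp → K.supp → V × V, Irr (G.induce K.supp) c := by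
  by_cases h : ∃ a b, (G.induce K.supp).Adj a b
  · obtain ⟨a, b, hab⟩ := h
    have hab' : G.Adj a b := hab
    have mem : ∀ (a : K.supp) (w : V), G.Adj a w → w ∈ K.supp := fun a w haw =>
      (SimpleGraph.ConnectedComponent.connectedComponentMk_eq_of_adj haw).symm.trans a.2
    have : ∃ c : K.supp → K.supp → K.supp × K.supp, Irr (G.induce K.supp) c := by
      by_cases h1 : ∃ w, G.Adj a w ∧ w ≠ b
      · obtain ⟨w, haw, hwb⟩ := h1
        exact exists_irr_of_path (x := ⟨w, mem a w haw⟩) (y := a) (z := b) (conn_component K)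
          haw.symm hab (fun h => hwb (congrArg Subtype.val h))
      · by_cases h2 : ∃ w, G.Adj b w ∧ w ≠ a
        · obtain ⟨w, hbw, hwa⟩ := h2
          exact exists_irr_of_path (x := ⟨w, mem b w hbw⟩) (y := b) (z := a) (conn_component K)
            hbw.symm hab.symm (fun h => hwa (congrArg Subtype.val h))
        · push Not at h1 h2
          exact absurd ⟨hab', h1, h2⟩ (hedge a b)
    obtain ⟨c, hc⟩ := this
    exact ⟨_, hc.map (f := Prod.map Subtype.val Subtype.val)
      (Subtype.val_injective.prodMap Subtype.val_injective)⟩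
  · obtain ⟨v⟩ := K.connected_toSimpleGraph.nonempty
    refine ⟨fun _ _ => (v, v), fun _ _ => rfl, fun φ _ w => ?_, fun i j _ ⟨a, b, hab, _⟩ =>
      absurd ⟨a, b, hab⟩ h⟩
    exact (conn_component K {w} (Set.subset_univ _) ⟨w, rfl⟩ fun a _ b _ hab =>
      absurd ⟨a, b, hab⟩ h) trivial

/-- Irreducible colourings of the components that are copies of each other on isomorphic
components, together with a colour from each. -/
theorem exists_irr_components (hedge : ∀ u v : V, ¬ IsolatedEdge G u v) :
    ∃ (q : ∀ K : G.ConnectedComponent, K.supp → K.supp → V × V)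
      (r : G.ConnectedComponent → G.ConnectedComponent) (σ : G.ConnectedComponent → V × V),
      (∀ K, Irr (G.induce K.supp) (q K)) ∧
      (∀ K K', Nonempty (G.induce K.supp ≃g G.induce K'.supp) → r K = r K') ∧
      (∀ K K', r K = r K' → ∃ T : G.induce K.supp ≃g G.induce K'.supp,
        ∀ a b, q K' (T a) (T b) = q K a b) ∧
      ∀ K a b, (G.induce K.supp).Adj a b → Used (G.induce K.supp) (q K) (σ (r K)) := by
  choose d hd using exists_irr_component hedge
  let S : Setoid G.ConnectedComponent :=
    ⟨fun K K' => Nonempty (G.induce K.supp ≃g G.induce K'.supp), fun K => ⟨SimpleGraph.Iso.refl⟩,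
      fun ⟨h⟩ => ⟨h.symm⟩, fun ⟨h⟩ ⟨h'⟩ => ⟨h.trans h'⟩⟩
  let r : G.ConnectedComponent → G.ConnectedComponent := fun K => (Quotient.mk S K).out
  have hθ : ∀ K, Nonempty (G.induce K.supp ≃g G.induce (r K).supp) := fun K =>
    S.symm (Quotient.mk_out (s := S) K)
  let θ := fun K => (hθ K).some
  have hσ : ∀ K : G.ConnectedComponent, ∃ p, ∀ a b, (G.induce K.supp).Adj a b →
      Used (G.induce K.supp) (d K) p := by
    intro K
    by_cases h : ∃ a b, (G.induce K.supp).Adj a b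
    · obtain ⟨a, b, hab⟩ := h
      exact ⟨d K a b, fun _ _ _ => ⟨a, b, hab, rfl⟩⟩
    · obtain ⟨v⟩ := K.connected_toSimpleGraph.nonempty
      exact ⟨(v, v), fun a b hab => absurd ⟨a, b, hab⟩ h⟩
  choose σ hσ using hσ
  refine ⟨fun K a b => d (r K) (θ K a) (θ K b), r, σ, fun K => (hd (r K)).comap (θ K),
    fun K K' h => ?_, fun K K' h => ?_, fun K a b hab => ?_⟩
  · exact congrArg Quotient.out (Quotient.sound (s := S) h)
  · have key : ∀ (R R' : G.ConnectedComponent) (_ : R = R') (t : G.induce K.supp ≃g G.induce R.supp)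
        (t' : G.induce K'.supp ≃g G.induce R'.supp), ∃ T : G.induce K.supp ≃g G.induce K'.supp,
        ∀ a b, d R' (t' (T a)) (t' (T b)) = d R (t a) (t b) := by
      rintro R _ rfl t t'
      exact ⟨t.trans t'.symm, fun a b => by simp⟩
    exact key _ _ h (θ K) (θ K')
  · obtain ⟨x, y, hxy, h⟩ := hσ (r K) _ _ ((θ K).map_rel_iff.2 hab)
    exact ⟨(θ K).symm x, (θ K).symm y, (θ K).symm.map_rel_iff.2 hxy, by simpa using h⟩

open Classical in
theorem exists_irr (hedge : ∀ u v : V, ¬ IsolatedEdge G u v)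
    (hvert : ∀ u v : V, IsolatedVertex G u → IsolatedVertex G v → u = v) :
    ∃ c : V → V → V × V, Irr G c := by
  obtain ⟨q, r, σ, hq, hiso, hT, hσ⟩ := exists_irr_components hedge
  let E : G.ConnectedComponent → V × V → (G.ConnectedComponent × V × V) ⊕ G.ConnectedComponent :=
    fun K p => if p = σ (r K) then .inr K else .inl (r K, p)
  let f : (G.ConnectedComponent × V × V) ⊕ G.ConnectedComponent → G.ConnectedComponent :=
    Sum.elim Prod.fst r
  let e : V → V → (G.ConnectedComponent × V × V) ⊕ G.ConnectedComponent := fun u v =>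
    if h : G.connectedComponentMk v = G.connectedComponentMk u then
      E (G.connectedComponentMk u) (q (G.connectedComponentMk u) ⟨u, rfl⟩ ⟨v, h⟩)
    else .inr (G.connectedComponentMk u)
  have he : ∀ (K : G.ConnectedComponent) (a b : K.supp), e a b = E K (q K a b) := by
    rintro K ⟨a, rfl⟩ ⟨b, hb⟩
    exact dif_pos hb
  have hfE : ∀ K p, f (E K p) = r K := by
    intro K p
    by_cases h : p = σ (r K) <;> simp [E, f, h]
  have hEinj : ∀ K p p', E K p = E K p' → p = p' := by
    intro K p p' h
    simp only [E] at h
    split_ifs at h with h1 h2 h2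
    · rw [h1, h2]
    · simpa using h
  have hEr : ∀ K, E K (σ (r K)) = .inr K := fun K => if_pos rfl
  have hEr' : ∀ K K' p, E K p = .inr K' → K = K' ∧ p = σ (r K) := by
    intro K K' p h
    simp only [E] at h
    split_ifs at h with h1
    · exact ⟨by simpa using h, h1⟩
  have hEeq : ∀ K K' p, r K = r K' → p ≠ σ (r K) → E K p = E K' p := by
    intro K K' p h1 h2
    simp only [E, if_neg h2, ← h1]
  have hadj : ∀ u v, G.Adj u v → ∃ (K : G.ConnectedComponent) (a b : K.supp),
      (a : V) = u ∧ (b : V) = v ∧ (G.induce K.supp).Adj a b := fun u v huv =>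
    ⟨G.connectedComponentMk u, ⟨u, rfl⟩,
      ⟨v, (SimpleGraph.ConnectedComponent.connectedComponentMk_eq_of_adj huv).symm⟩, rfl, rfl, huv⟩
  have hφ : ∀ (φ : G ≃g G) (K : G.ConnectedComponent) (x : K.supp), ∃ K' : G.ConnectedComponent,
      ∃ g : G.induce K.supp ≃g G.induce K'.supp, ∀ a, (g a : V) = φ a := by
    rintro φ _ ⟨x, rfl⟩
    exact ⟨_, exists_restrict φ x⟩
  have hused : ∀ i, Used G e i → ∃ K p, i = E K p ∧ Used (G.induce K.supp) (q K) p := by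
    rintro _ ⟨u, v, huv, rfl⟩
    obtain ⟨K, a, b, rfl, rfl, hab⟩ := hadj u v huv
    exact ⟨K, q K a b, he K a b, a, b, hab, rfl⟩
  have husedT : ∀ K K' p, r K = r K' → Used (G.induce K.supp) (q K) p →
      Used (G.induce K'.supp) (q K') p := by
    rintro K K' _ h ⟨a, b, hab, rfl⟩
    obtain ⟨T, hT⟩ := hT K K' h
    exact ⟨T a, T b, T.map_rel_iff.2 hab, hT a b⟩
  have hlocal : ∀ K p p', p ≠ p' → Used (G.induce K.supp) (q K) p →
      Used (G.induce K.supp) (q K) p' → Swaps G e (E K p) (E K p') := by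
    intro K p p' hne hp hp'
    obtain ⟨g, ⟨x, hx⟩, hg⟩ := (hq K).swaps p p' hne hp hp'
    have hex : ∀ L : G.ConnectedComponent, ∃ T : G.induce L.supp ≃g G.induce L.supp,
        (∀ h : L = K, ∃ x, T x ≠ x) ∧ ∀ a b, (G.induce L.supp).Adj a b →
          q L (T a) (T b) = q L a b ∨ L = K ∧ (q L a b = p ∧ q L (T a) (T b) = p' ∨
            q L a b = p' ∧ q L (T a) (T b) = p) := by
      intro L
      by_cases h : L = K
      · subst h
        exact ⟨g, fun _ => ⟨x, hx⟩, fun a b hab => (hg a b hab).imp_right fun h => ⟨rfl, h⟩⟩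
      · exact ⟨SimpleGraph.Iso.refl, fun h' => absurd h' h, fun a b _ => .inl rfl⟩
    choose T h1 h2 using hex
    obtain ⟨ψ, hψ⟩ : ∃ ψ : G ≃g G, ∀ (L : G.ConnectedComponent) (a : L.supp), ψ a = T L a :=
      exists_glue (Equiv.refl _) T
    refine ⟨ψ, ?_, fun u v huv => ?_⟩
    · obtain ⟨x, hx⟩ := h1 K rfl
      exact ⟨x, fun h => hx (Subtype.ext ((hψ K x).symm.trans h))⟩
    · obtain ⟨L, a, b, rfl, rfl, hab⟩ := hadj u v huv
      rw [hψ, hψ, he L (T L a), he L a b]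
      rcases h2 L a b hab with h | ⟨rfl, h | h⟩
      · left; rw [h]
      · right; left; rw [h.1, h.2]; exact ⟨rfl, rfl⟩
      · right; right; rw [h.1, h.2]; exact ⟨rfl, rfl⟩
  refine exists_irr_of_fibres e f (fun a b hab => ?_) (fun φ hpres v => ?_)
    (fun φ a b hab => ?_) (fun i j hij hne hi hj => ?_)
  · obtain ⟨K, a, b, rfl, rfl, -⟩ := hadj a b hab
    rw [he, he K b a, (hq K).symm]
  · by_cases hv : IsolatedVertex G v
    · refine hvert _ _ (fun w hw => ?_) hv
      exact hv (φ.symm w) (by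
        have := φ.symm.map_rel_iff.2 hw
        simpa using this)
    have hv' : ∃ w, G.Adj v w := by
      simpa [IsolatedVertex] using hv
    obtain ⟨w, hvw⟩ := hv'
    obtain ⟨K, a, b, rfl, rfl, hab⟩ := hadj v w hvw
    obtain ⟨K', g, hg⟩ := hφ φ K a
    have hK : K' = K := by
      obtain ⟨x, y, hxy, h⟩ := hσ K a b hab
      have h3 := hpres x y hxy
      rw [← hg, ← hg, he, he K x y, h, hEr] at h3
      exact (hEr' _ _ _ h3).1
    subst hK
    have := (hq K').dist g (fun x y hxy => hEinj K' _ _ (by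
      rw [← he, ← he, hg, hg]; exact hpres x y hxy)) a
    rw [← hg, this]
  · obtain ⟨K, a, b, rfl, rfl, hab⟩ := hadj a b hab
    obtain ⟨K', g, hg⟩ := hφ φ K a
    rw [← hg, ← hg, he, he K a b, hfE, hfE]
    exact (hiso K K' ⟨g⟩).symm
  · obtain ⟨K, p, rfl, hp⟩ := hused i hi
    obtain ⟨K', p', rfl, hp'⟩ := hused j hj
    rw [hfE, hfE] at hij
    by_cases h1 : p = σ (r K)
    · by_cases h2 : p' = σ (r K')
      · have hKK : K ≠ K' := by
          rintro rfl
          exact hne (by rw [h1, h2])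
        have hex : ∀ L : G.ConnectedComponent,
            ∃ T : G.induce L.supp ≃g G.induce (Equiv.swap K K' L).supp,
              ∀ a b, q _ (T a) (T b) = q L a b := by
          intro L
          refine hT _ _ ?_
          by_cases hL : L = K
          · subst hL; rw [Equiv.swap_apply_left]; exact hij
          by_cases hL' : L = K'
          · subst hL'; rw [Equiv.swap_apply_right]; exact hij.symm
          rw [Equiv.swap_apply_of_ne_of_ne hL hL']
        choose T hT' using hex
        obtain ⟨ψ, hψ⟩ := exists_glue (Equiv.swap K K') T
        have hr : ∀ L, r (Equiv.swap K K' L) = r L := fun L => (hiso _ _ ⟨T L⟩).symm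
        refine ⟨ψ, ?_, fun u v huv => ?_⟩
        · obtain ⟨a, -⟩ := hp
          refine ⟨a, fun h => hKK ?_⟩
          have h3 := (T K a).2
          rw [← hψ, h, SimpleGraph.ConnectedComponent.mem_supp_iff,
            (SimpleGraph.ConnectedComponent.mem_supp_iff K _).1 a.2, Equiv.swap_apply_left] at h3
          exact h3
        · obtain ⟨L, a, b, rfl, rfl, hab⟩ := hadj u v huv
          rw [hψ, hψ, he _ (T L a) (T L b), he L a b, hT']
          by_cases h3 : q L a b = σ (r L)
          · have h4 : E (Equiv.swap K K' L) (q L a b) = .inr (Equiv.swap K K' L) := by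
              rw [h3, ← hr L, hEr]
            rw [h4, h3, h1, h2, hEr, hEr, hEr]
            by_cases hL : L = K
            · subst hL; right; left; exact ⟨rfl, by rw [Equiv.swap_apply_left]⟩
            by_cases hL' : L = K'
            · subst hL'; right; right; exact ⟨rfl, by rw [Equiv.swap_apply_right]⟩
            left; rw [Equiv.swap_apply_of_ne_of_ne hL hL']
          · left
            exact (hEeq _ _ _ (hr L).symm h3).symm
      · have h4 := hEeq K' K p' hij.symm h2
        rw [h4] at hne ⊢
        exact hlocal K p p' (fun h => hne (by rw [h])) hp (husedT _ _ _ hij.symm hp')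
    · have h4 := hEeq K K' p hij h1
      rw [h4] at hne ⊢
      exact hlocal K' p p' (fun h => hne (by rw [h])) (husedT _ _ _ hij hp) hp'

end IrrCol

theorem mergeMap_eq {C : Type w} {a b x y : C}
    (h : x = y ∨ (x = a ∧ y = b) ∨ (x = b ∧ y = a)) : mergeMap a b x = mergeMap a b y := by
  unfold mergeMap
  rcases h with rfl | ⟨rfl, rfl⟩ | ⟨rfl, rfl⟩
  · rfl
  · simp
  · simp

/-- every simple graph with no isolated edge and at most one
isolated vertex has an irreducible distinguishing edge colouring. -/
theorem stmt10 {V : Type u} (G : SimpleGraph V)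
    (hedge : ∀ u v : V, ¬ IsolatedEdge G u v)
    (hvert : ∀ u v : V, IsolatedVertex G u → IsolatedVertex G v → u = v) :
    ∃ (C : Type u) (c : G.edgeSet → C),
      EdgeDistinguishing G c ∧
        ∀ a b : C, a ≠ b → b ∈ Set.range c →
          ¬ EdgeDistinguishing G (mergeMap a b ∘ c) := by
  obtain ⟨c, hc⟩ := IrrCol.exists_irr hedge hvert
  let d : G.edgeSet → V × V := fun e => Sym2.lift ⟨c, hc.symm⟩ e.1
  refine ⟨Set.range d, Set.rangeFactorization d, fun φ h => hc.dist φ fun u v huv => ?_, ?_⟩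
  · exact congrArg Subtype.val (h ⟨s(u, v), huv⟩)
  · rintro ⟨_, ⟨⟨a, b⟩, hab⟩, rfl⟩ ⟨_, ⟨⟨a', b'⟩, hab'⟩, rfl⟩ hne - hdist
    obtain ⟨ψ, ⟨v, hv⟩, hψ⟩ := hc.swaps (c a b) (c a' b')
      (fun h => hne (Subtype.ext h)) ⟨a, b, hab, rfl⟩ ⟨a', b', hab', rfl⟩
    refine hv (hdist ψ ?_ v)
    rintro ⟨⟨x, y⟩, hxy⟩
    refine mergeMap_eq ?_
    rcases hψ x y hxy with h | h | h
    · exact .inl (Subtype.ext h)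
    · exact .inr (.inr ⟨Subtype.ext h.2, Subtype.ext h.1⟩)
    · exact .inr (.inl ⟨Subtype.ext h.2, Subtype.ext h.1⟩)
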